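/- arXiv:0911.3633 — 2 statements merged into one kernel-verified Lean document; each statement's English description precedes it below -/
import Mathlib

section
/- Any d-maximum class C ⊆ {0,1}^n induced by a simple linear arrangement of n hyperplanes in ℝ^d (n ≥ d ≥ 1) can be d-corner-peeled, and the resulting corner-peeling yields an unlabeled compression scheme for C of size d. -/
open Finset

namespace GeomCompress

/-- `C` shatters the coordinate set `Y`: every pattern on `Y` is realized by some concept. -/
def Shatters {n : ℕ} (C : Finset (Fin n → Bool)) (Y : Finset (Fin n)) : Prop :=
  ∀ p : Fin n → Bool, ∃ c ∈ C, ∀ i ∈ Y, c i = p i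

/-- The VC dimension of `C` equals `d`. -/
def VCDimEq {n : ℕ} (C : Finset (Fin n → Bool)) (d : ℕ) : Prop :=
  (∃ Y : Finset (Fin n), Y.card = d ∧ Shatters C Y) ∧
    ∀ Y : Finset (Fin n), Shatters C Y → Y.card ≤ d

/-- `C` is a `d`-maximum class: VC dimension `d` and maximum possible cardinality. -/
def IsMaximum {n : ℕ} (C : Finset (Fin n → Bool)) (d : ℕ) : Prop :=
  VCDimEq C d ∧ C.card = ∑ i ∈ Finset.range (d + 1), Nat.choose n i

/-- Hamming distance between two Boolean vectors. -/
def hamming {n : ℕ} (u v : Fin n → Bool) : ℕ :=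
  (Finset.univ.filter fun i => u i ≠ v i).card

/-- Adjacency in the one-inclusion graph: differ in exactly one coordinate. -/
def Adj {n : ℕ} (u v : Fin n → Bool) : Prop := hamming u v = 1

instance {n : ℕ} (u v : Fin n → Bool) : Decidable (Adj u v) := by
  unfold Adj; infer_instance

/-- `Q` is a cube of `C` colored by `I`: a subset of `C` whose elements agree outside `I`
and realize all patterns on `I`. -/
def IsCube {n : ℕ} (C Q : Finset (Fin n → Bool)) (I : Finset (Fin n)) : Prop :=
  Q ⊆ C ∧ (∀ u ∈ Q, ∀ v ∈ Q, ∀ i, i ∉ I → u i = v i) ∧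
    ∀ p : Fin n → Bool, ∃ u ∈ Q, ∀ i ∈ I, u i = p i

/-- `v` is a corner vertex of `C`: there is a unique cube of maximum dimension among all
cubes of `C` containing `v`, and all neighbors of `v` in the one-inclusion graph of `C`
lie in that cube. -/
def IsCorner {n : ℕ} (C : Finset (Fin n → Bool)) (v : Fin n → Bool) : Prop :=
  ∃ Q I, IsCube C Q I ∧ v ∈ Q ∧
    (∀ Q' I', IsCube C Q' I' → v ∈ Q' → I'.card ≤ I.card) ∧
    (∀ Q' I', IsCube C Q' I' → v ∈ Q' → I'.card = I.card → Q' = Q) ∧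
    ∀ u ∈ C, Adj u v → u ∈ Q

/-- The class remaining after peeling the first `t` vertices of the ordering `v`. -/
def Peeled {n m : ℕ} (C : Finset (Fin n → Bool)) (v : Fin m → (Fin n → Bool)) (t : Fin m) :
    Finset (Fin n → Bool) :=
  C \ (Finset.univ.filter fun s : Fin m => s < t).image v

/-- `v` is a corner-peeling ordering of `C`: an enumeration of `C` such that each `v t`
is a corner vertex of the class remaining before step `t`. -/
def IsCornerPeeling {n : ℕ} (C : Finset (Fin n → Bool)) (v : Fin C.card → (Fin n → Bool)) :
    Prop :=
  Function.Injective v ∧ (∀ t, v t ∈ C) ∧ ∀ t, IsCorner (Peeled C v t) (v t)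

/-- Degree of `v` in the one-inclusion graph of `C`. -/
def degreeIn {n : ℕ} (C : Finset (Fin n → Bool)) (v : Fin n → Bool) : ℕ :=
  (C.filter fun u => Adj u v).card

/-- The colors of the edges incident to `v` in the one-inclusion graph of `C`. -/
def incidentColors {n : ℕ} (C : Finset (Fin n → Bool)) (v : Fin n → Bool) : Finset (Fin n) :=
  Finset.univ.filter fun i => ∃ u ∈ C, Adj u v ∧ u i ≠ v i

/-- `C` is shortest-path closed: any two concepts are joined in the one-inclusion graph of
`C` by a path whose length is their Hamming distance. -/
def SPClosed {n : ℕ} (C : Finset (Fin n → Bool)) : Prop :=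
  ∀ u ∈ C, ∀ v ∈ C, ∃ p : ℕ → (Fin n → Bool),
    p 0 = u ∧ p (hamming u v) = v ∧ (∀ k ≤ hamming u v, p k ∈ C) ∧
    ∀ k < hamming u v, Adj (p k) (p (k + 1))

/-- `Q` (colored by `I`, with `I.card = d - 1`) is a cube of the boundary `∂C` of the
`d`-maximum class `C`: it is a face of exactly one `d`-cube of `C`. -/
def IsBoundaryCube {n : ℕ} (C : Finset (Fin n → Bool)) (d : ℕ)
    (Q : Finset (Fin n → Bool)) (I : Finset (Fin n)) : Prop :=
  IsCube C Q I ∧ I.card = d - 1 ∧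
    (∃ Q' I', IsCube C Q' I' ∧ I'.card = d ∧ Q ⊆ Q' ∧ I ⊆ I') ∧
    ∀ Q₁ I₁ Q₂ I₂, IsCube C Q₁ I₁ → I₁.card = d → Q ⊆ Q₁ → I ⊆ I₁ →
      IsCube C Q₂ I₂ → I₂.card = d → Q ⊆ Q₂ → I ⊆ I₂ → Q₁ = Q₂

/-- Standard inner product on `Fin d → ℝ`. -/
def dotR {d : ℕ} (x y : Fin d → ℝ) : ℝ := ∑ i, x i * y i

/-- `x` lies on none of the hyperplanes `⟪a i, ·⟫ = b i`. -/
def OnNoHyperplane {d N : ℕ} (a : Fin N → Fin d → ℝ) (b : Fin N → ℝ) (x : Fin d → ℝ) :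
    Prop :=
  ∀ i, dotR (a i) x ≠ b i

/-- The sign vector of the point `x` with respect to the oriented hyperplanes `(a, b)`. -/
noncomputable def signVec {d N : ℕ} (a : Fin N → Fin d → ℝ) (b : Fin N → ℝ)
    (x : Fin d → ℝ) : Fin N → Bool :=
  fun i => decide (b i < dotR (a i) x)

/-- `C` is the concept class induced by the arrangement `(a, b)`: the set of sign vectors
of points lying on none of the hyperplanes. -/
def IsInducedClass {d N : ℕ} (a : Fin N → Fin d → ℝ) (b : Fin N → ℝ)
    (C : Finset (Fin N → Bool)) : Prop :=
  ∀ c, c ∈ C ↔ ∃ x : Fin d → ℝ, OnNoHyperplane a b x ∧ signVec a b x = c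

/-- A simple linear arrangement in `ℝ^d`: every `≤ d` of the hyperplanes are in general
position (normals linearly independent, so every `k ≤ d` of them intersect in an affine
subspace of dimension `d - k`), and every `d+1` of them have empty common intersection. -/
def SimpleArrangement (d : ℕ) {N : ℕ} (a : Fin N → Fin d → ℝ) (b : Fin N → ℝ) : Prop :=
  (∀ S : Finset (Fin N), S.card ≤ d → LinearIndependent ℝ (fun i : S => a i.1)) ∧
    ∀ S : Finset (Fin N), S.card = d + 1 → ¬∃ x : Fin d → ℝ, ∀ i ∈ S, dotR (a i) x = b i

/-- Membership in the open unit ball (Klein model of hyperbolic space `H^k`). -/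
def inBall {k : ℕ} (x : Fin k → ℝ) : Prop := ∑ i, x i ^ 2 < 1

/-- A simple hyperbolic `d`-arrangement in the Klein model `H^k`: every `d` of the
hyperplanes intersect inside the unit ball in a `(k-d)`-dimensional hyperbolic plane
(normals independent and common point inside the ball), and every `d+1` of them have
empty common intersection inside the ball. -/
def SimpleHyperbolicArrangement (d : ℕ) {k N : ℕ} (a : Fin N → Fin k → ℝ)
    (b : Fin N → ℝ) : Prop :=
  (∀ S : Finset (Fin N), S.card = d →
      LinearIndependent ℝ (fun i : S => a i.1) ∧
        ∃ x : Fin k → ℝ, inBall x ∧ ∀ i ∈ S, dotR (a i) x = b i) ∧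
    ∀ S : Finset (Fin N), S.card = d + 1 →
      ¬∃ x : Fin k → ℝ, inBall x ∧ ∀ i ∈ S, dotR (a i) x = b i

/-- The concept class induced by a hyperbolic arrangement: sign vectors of points of the
open unit ball lying on none of the hyperplanes. -/
def IsInducedClassH {k N : ℕ} (a : Fin N → Fin k → ℝ) (b : Fin N → ℝ)
    (C : Finset (Fin N → Bool)) : Prop :=
  ∀ c, c ∈ C ↔ ∃ x : Fin k → ℝ, inBall x ∧ OnNoHyperplane a b x ∧ signVec a b x = c

/-- A generic arrangement of oriented affine hyperplanes in `ℝ^n`: every subcollection of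
`k` hyperplanes, `2 ≤ k ≤ n`, either has empty common intersection or intersects
transversely (normals linearly independent, giving an affine subspace of dim `n - k`). -/
def GenericArrangement {n N : ℕ} (a : Fin N → Fin n → ℝ) (b : Fin N → ℝ) : Prop :=
  ∀ S : Finset (Fin N), 2 ≤ S.card → S.card ≤ n →
    (¬∃ x : Fin n → ℝ, ∀ i ∈ S, dotR (a i) x = b i) ∨
      LinearIndependent ℝ (fun i : S => a i.1)

/-- `C` is a maximal class of VC dimension `d`: adding any new concept increases the VC
dimension. -/
def IsMaximalClass {n : ℕ} (C : Finset (Fin n → Bool)) (d : ℕ) : Prop :=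
  VCDimEq C d ∧
    ∀ c : Fin n → Bool, c ∉ C →
      ∃ Y : Finset (Fin n), d < Y.card ∧ Shatters (insert c C) Y

/-- A path in the one-inclusion graph of `C` avoiding `C'`, from a vertex of `Q1` to a
vertex of `Q2`. -/
def CConnPath {n : ℕ} (C C' Q1 Q2 : Finset (Fin n → Bool)) : Prop :=
  ∃ (L : ℕ) (p : ℕ → Fin n → Bool),
    p 0 ∈ Q1 ∧ p L ∈ Q2 ∧ (∀ j ≤ L, p j ∈ C ∧ p j ∉ C') ∧
      ∀ j < L, Adj (p j) (p (j + 1))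

/-- `Q1` and `Q2` are `d`-cubes of `C` joined by a path of the one-inclusion graph of `C`
avoiding `C'`. -/
def CComponentRel {n : ℕ} (C C' : Finset (Fin n → Bool)) (d : ℕ)
    (Q1 Q2 : Finset (Fin n → Bool)) : Prop :=
  (∃ I, IsCube C Q1 I ∧ I.card = d) ∧ (∃ I, IsCube C Q2 I ∧ I.card = d) ∧
    CConnPath C C' Q1 Q2

/-- `Comp` enumerates the `C'`-connected components of `C`: each component is a union of
`d`-cubes of `C`, every `d`-cube lies in exactly one component, and two `d`-cubes lie in
the same component iff they are related under the transitive closure of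
`C'`-connectedness. -/
def IsComponents {n : ℕ} (C C' : Finset (Fin n → Bool)) (d : ℕ) {k : ℕ}
    (Comp : Fin k → Finset (Fin n → Bool)) : Prop :=
  (∀ q, ∀ x ∈ Comp q, ∃ Q I, IsCube C Q I ∧ I.card = d ∧ x ∈ Q ∧ Q ⊆ Comp q) ∧
  (∀ Q I, IsCube C Q I → I.card = d → ∃ q, Q ⊆ Comp q) ∧
  (∀ q q' Q I, IsCube C Q I → I.card = d → Q ⊆ Comp q → Q ⊆ Comp q' → q = q') ∧
  ∀ q Q1 I1, IsCube C Q1 I1 → I1.card = d → Q1 ⊆ Comp q →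
    ∀ Q2 I2, IsCube C Q2 I2 → I2.card = d →
      (Q2 ⊆ Comp q ↔ Relation.TransGen (CComponentRel C C' d) Q1 Q2)

/-- Append the bit `b` as a new last coordinate. -/
def app {n : ℕ} (c : Fin n → Bool) (b : Bool) : Fin (n + 1) → Bool := Fin.snoc c b

/-- The lift `(C' × {0,1}) ∪ ⋃_q (Comp q × {p q})`. -/
def LiftClass {n k : ℕ} (C' : Finset (Fin n → Bool))
    (Comp : Fin k → Finset (Fin n → Bool)) (p : Fin k → Bool) :
    Finset (Fin (n + 1) → Bool) :=
  C'.image (fun c => app c false) ∪ C'.image (fun c => app c true) ∪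
    Finset.univ.biUnion fun q => (Comp q).image fun c => app c (p q)

section Combinatorics

variable {n : ℕ}

lemma adj_iff_exists_update (u v : Fin n → Bool) :
    Adj u v ↔ ∃ i, u = Function.update v i (!v i) := by
  unfold Adj hamming
  rw [Finset.card_eq_one]
  constructor
  · rintro ⟨i, hi⟩
    refine ⟨i, funext fun k => ?_⟩
    have hk : u k ≠ v k ↔ k = i := by
      simpa using congrArg (k ∈ ·) hi
    by_cases h : k = i
    · subst h
      have := hk.2 rfl
      rw [Function.update_self]
      cases h1 : u k <;> cases h2 : v k <;> simp_all
    · rw [Function.update_of_ne h]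
      by_contra h'
      exact h (hk.1 h')
  · rintro ⟨i, rfl⟩
    refine ⟨i, ?_⟩
    ext k
    by_cases h : k = i
    · subst h; simp
    · simp [h]

/-- `I` is a set of colors at `v` such that the full `I`-cube through `v` lies in `R`, while no
other element of `R` agrees with `v` on `I`. -/
structure IsCornerColoring (R : Finset (Fin n → Bool)) (v : Fin n → Bool) (I : Finset (Fin n)) :
    Prop where
  eq_of_agree : ∀ c ∈ R, (∀ i ∈ I, c i = v i) → c = v
  mem_of_agree_compl : ∀ c, (∀ i, i ∉ I → c i = v i) → c ∈ R

namespace IsCornerColoring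

variable {R : Finset (Fin n → Bool)} {v : Fin n → Bool} {I : Finset (Fin n)}

lemma update_mem_iff (h : IsCornerColoring R v I) (i : Fin n) :
    Function.update v i (!v i) ∈ R ↔ i ∈ I := by
  constructor
  · intro hu
    by_contra hi
    have := h.eq_of_agree _ hu fun k hk => Function.update_of_ne (by rintro rfl; exact hi hk) _ _
    simpa using congrFun this i
  · intro hi
    exact h.mem_of_agree_compl _ fun k hk =>
      Function.update_of_ne (by rintro rfl; exact hk hi) _ _

lemma incidentColors_eq (h : IsCornerColoring R v I) : incidentColors R v = I := by
  ext i
  simp only [incidentColors, mem_filter, mem_univ, true_and]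
  constructor
  · rintro ⟨u, hu, huv, hi⟩
    obtain ⟨k, rfl⟩ := (adj_iff_exists_update _ _).1 huv
    obtain rfl : i = k := by
      by_contra hik
      exact hi (Function.update_of_ne hik _ _)
    exact (h.update_mem_iff i).1 hu
  · intro hi
    exact ⟨_, (h.update_mem_iff i).2 hi, (adj_iff_exists_update _ _).2 ⟨i, rfl⟩, by simp⟩

lemma degreeIn_le (h : IsCornerColoring R v I) : degreeIn R v ≤ I.card := by
  unfold degreeIn
  refine (card_le_card ?_).trans (card_image_le (f := fun i => Function.update v i (!v i)))
  intro u hu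
  obtain ⟨hu, huv⟩ := mem_filter.1 hu
  obtain ⟨k, rfl⟩ := (adj_iff_exists_update _ _).1 huv
  exact mem_image.2 ⟨k, (h.update_mem_iff k).1 hu, rfl⟩

lemma subset_of_isCube (h : IsCornerColoring R v I) {Q : Finset (Fin n → Bool)}
    {J : Finset (Fin n)} (hQ : IsCube R Q J) (hv : v ∈ Q) : J ⊆ I := by
  intro i hi
  obtain ⟨hQR, hQJ, hpat⟩ := hQ
  obtain ⟨u, huQ, hu⟩ := hpat (Function.update v i (!v i))
  have : u = Function.update v i (!v i) := by
    funext k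
    by_cases hk : k ∈ J
    · exact hu k hk
    · rw [Function.update_of_ne (by rintro rfl; exact hk hi)]
      exact hQJ _ huQ _ hv _ hk
  exact (h.update_mem_iff i).1 (this ▸ hQR huQ)

lemma isCorner (h : IsCornerColoring R v I) : IsCorner R v := by
  refine ⟨univ.filter fun c => ∀ i, i ∉ I → c i = v i, I, ⟨?_, ?_, ?_⟩, by simp, ?_, ?_, ?_⟩
  · intro c hc
    exact h.mem_of_agree_compl c (by simpa using hc)
  · intro u hu w hw i hi
    rw [(mem_filter.1 hu).2 i hi, (mem_filter.1 hw).2 i hi]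
  · intro p
    exact ⟨fun i => if i ∈ I then p i else v i, by simp +contextual, by simp +contextual⟩
  · intro Q' I' hQ' hv
    exact card_le_card (h.subset_of_isCube hQ' hv)
  · intro Q' I' hQ' hv hcard
    obtain rfl := eq_of_subset_of_card_le (h.subset_of_isCube hQ' hv) hcard.ge
    obtain ⟨-, hQJ, hpat⟩ := hQ'
    ext c
    simp only [mem_filter, mem_univ, true_and]
    refine ⟨fun hc i hi => hQJ _ hc _ hv _ hi, fun hc => ?_⟩
    obtain ⟨u, huQ, hu⟩ := hpat c
    have : u = c := by
      funext k
      by_cases hk : k ∈ I'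
      · exact hu k hk
      · rw [hc k hk]
        exact hQJ _ huQ _ hv _ hk
    exact this ▸ huQ
  · intro u hu huv
    obtain ⟨k, rfl⟩ := (adj_iff_exists_update _ _).1 huv
    have hk := (h.update_mem_iff k).1 hu
    simp only [mem_filter, mem_univ, true_and]
    intro i hi
    exact Function.update_of_ne (by rintro rfl; exact hi hk) _ _

end IsCornerColoring

lemma card_filter_card_le (n d : ℕ) :
    (univ.filter fun I : Finset (Fin n) => I.card ≤ d).card
      = ∑ i ∈ Finset.range (d + 1), Nat.choose n i := by
  rw [card_eq_sum_card_fiberwise (f := Finset.card) (t := Finset.range (d + 1))]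
  · refine sum_congr rfl fun i hi => ?_
    have : (univ.filter fun I : Finset (Fin n) => I.card ≤ d).filter (fun I => I.card = i)
        = powersetCard i univ := by
      ext I
      have := mem_range.1 hi
      simp only [mem_filter, mem_univ, true_and, mem_powersetCard, subset_univ]
      omega
    rw [this, card_powersetCard, card_univ, Fintype.card_fin]
  · intro I hI
    have : I.card ≤ d := by simpa using hI
    simpa using Nat.lt_succ_of_le this

lemma exists_antitone_enumeration {α : Type*} (C : Finset α) (D : α → ℝ) :
    ∃ v : Fin C.card → α, Function.Injective v ∧ (∀ c, c ∈ C ↔ ∃ t, v t = c) ∧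
      Antitone (D ∘ v) := by
  classical
  let e := C.equivFin.symm
  let f : Fin C.card → ℝ := fun k => -D (e k)
  refine ⟨fun k => e (Tuple.sort f k), ?_, ?_, ?_⟩
  · exact Subtype.val_injective.comp (e.injective.comp (Tuple.sort f).injective)
  · intro c
    constructor
    · intro hc
      exact ⟨(Tuple.sort f).symm (e.symm ⟨c, hc⟩), by simp⟩
    · rintro ⟨t, rfl⟩
      exact (e _).2
  · intro s t hst
    have := Tuple.monotone_sort f hst
    simp only [Function.comp_apply, f] at this ⊢
    linarith

/-- Peeling in order of decreasing `D` is a corner-peeling and gives a compression scheme, provided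
each `c ∈ C` has a color set `I c` such that other concepts agreeing with `c` on `I c` have larger
`D`, and the full `I c`-cube at `c` lies in `C` and its other elements have smaller `D`. -/
theorem exists_cornerPeeling_of_potential {d : ℕ} (C : Finset (Fin n → Bool))
    (hcard : C.card = ∑ i ∈ Finset.range (d + 1), Nat.choose n i)
    (D : (Fin n → Bool) → ℝ) (I : (Fin n → Bool) → Finset (Fin n))
    (hI : ∀ c ∈ C, (I c).card ≤ d)
    (hagree : ∀ c ∈ C, ∀ c' ∈ C, (∀ i ∈ I c, c' i = c i) → c' ≠ c → D c < D c')
    (hcube : ∀ c ∈ C, ∀ c', (∀ i, i ∉ I c → c' i = c i) → c' ≠ c → c' ∈ C ∧ D c' < D c) :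
    ∃ v : Fin C.card → (Fin n → Bool),
      IsCornerPeeling C v ∧
      (∀ t, degreeIn (Peeled C v t) (v t) ≤ d) ∧
      (Function.Injective fun t => incidentColors (Peeled C v t) (v t)) ∧
      (∀ I : Finset (Fin n), I.card ≤ d ↔ ∃ t, incidentColors (Peeled C v t) (v t) = I) ∧
      (∀ s t : Fin C.card, s ≠ t →
        ∃ i ∈ incidentColors (Peeled C v s) (v s) ∪ incidentColors (Peeled C v t) (v t),
          v s i ≠ v t i) := by
  obtain ⟨v, hinj, hmem, hanti⟩ := exists_antitone_enumeration C D
  have hvC : ∀ t, v t ∈ C := fun t => (hmem _).2 ⟨t, rfl⟩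
  have hpeel : ∀ s t, v s ∈ Peeled C v t ↔ t ≤ s := by
    intro s t
    simp only [Peeled, mem_sdiff, hvC, true_and, mem_image, mem_filter, mem_univ, not_exists,
      not_and]
    refine ⟨fun h => not_lt.1 fun hst => h s hst rfl, fun h k hk hks => ?_⟩
    rw [hinj hks] at hk
    exact absurd hk (not_lt.2 h)
  have hcol : ∀ t, IsCornerColoring (Peeled C v t) (v t) (I (v t)) := by
    intro t
    refine ⟨fun c hc hag => ?_, fun c hc => ?_⟩
    · obtain ⟨s, rfl⟩ := (hmem c).1 (mem_sdiff.1 hc).1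
      by_contra hne
      exact absurd (hagree _ (hvC t) _ (hvC s) hag hne) (not_lt.2 (hanti ((hpeel s t).1 hc)))
    · by_cases hne : c = v t
      · rw [hne, hpeel]
      · obtain ⟨hcC, hD⟩ := hcube _ (hvC t) c hc hne
        obtain ⟨s, rfl⟩ := (hmem c).1 hcC
        rw [hpeel]
        by_contra hst
        exact absurd hD (not_lt.2 (hanti (not_le.1 hst).le))
  have hclash : ∀ s t, s < t → ∃ i ∈ I (v s), v s i ≠ v t i := by
    intro s t hst
    by_contra! hag
    exact hst.ne' (hinj ((hcol s).eq_of_agree _ ((hpeel t s).2 hst.le) fun i hi => (hag i hi).symm))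
  have hne : ∀ s t, s < t → I (v s) ≠ I (v t) := by
    intro s t hst hst'
    obtain ⟨k, hk⟩ := (hmem (fun i => if i ∈ I (v t) then v s i else v t i)).1
      (mem_sdiff.1 ((hcol t).mem_of_agree_compl _ (by simp +contextual))).1
    have hkt : t ≤ k := by
      rw [← hpeel, hk]
      exact (hcol t).mem_of_agree_compl _ (by simp +contextual)
    have hks : v k = v s := by
      refine (hcol s).eq_of_agree _ ((hpeel k s).2 (hst.le.trans hkt)) fun i hi => ?_
      rw [hst'] at hi
      simp [hk, hi]
    exact absurd (hinj hks ▸ hkt) (not_le.2 hst)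
  have hIinj : Function.Injective fun t => I (v t) := by
    intro s t hst
    rcases lt_trichotomy s t with h | h | h
    · exact absurd hst (hne s t h)
    · exact h
    · exact absurd hst.symm (hne t s h)
  have hsurj : univ.image (fun t => I (v t)) = univ.filter fun J : Finset (Fin n) => J.card ≤ d := by
    refine eq_of_subset_of_card_le ?_ ?_
    · intro J hJ
      obtain ⟨t, -, rfl⟩ := mem_image.1 hJ
      simpa using hI _ (hvC t)
    · rw [card_filter_card_le, ← hcard, card_image_of_injective _ hIinj, card_univ,
        Fintype.card_fin]
  refine ⟨v, ⟨hinj, hvC, fun t => (hcol t).isCorner⟩,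
    fun t => (hcol t).degreeIn_le.trans (hI _ (hvC t)), ?_, ?_, ?_⟩
  · simpa only [fun t => (hcol t).incidentColors_eq] using hIinj
  · intro J
    simpa [(hcol _).incidentColors_eq] using (congrArg (J ∈ ·) hsurj).symm.to_iff
  · intro s t hst
    rw [(hcol s).incidentColors_eq, (hcol t).incidentColors_eq]
    rcases lt_or_gt_of_ne hst with h | h
    · obtain ⟨i, hi, hi'⟩ := hclash s t h
      exact ⟨i, mem_union_left _ hi, hi'⟩
    · obtain ⟨i, hi, hi'⟩ := hclash t s h
      exact ⟨i, mem_union_right _ hi, hi'.symm⟩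

end Combinatorics

section Geometry

open Filter Topology

variable {d n : ℕ}

lemma dotR_add_smul (y q u : Fin d → ℝ) (ε : ℝ) :
    dotR y (q + ε • u) = dotR y q + ε * dotR y u := by
  simp only [dotR, Pi.add_apply, Pi.smul_apply, smul_eq_mul, mul_add, sum_add_distrib, mul_sum]
  congr 1
  exact sum_congr rfl fun i _ => by ring

lemma dotR_sum_left (I : Finset (Fin n)) (μ : Fin n → ℝ) (a : Fin n → Fin d → ℝ)
    (x : Fin d → ℝ) : dotR (∑ i ∈ I, μ i • a i) x = ∑ i ∈ I, μ i * dotR (a i) x := by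
  simp only [dotR, Finset.sum_apply, Pi.smul_apply, smul_eq_mul, sum_mul, mul_sum]
  rw [sum_comm]
  exact sum_congr rfl fun i _ => sum_congr rfl fun j _ => by ring

lemma dotR_comm (x y : Fin d → ℝ) : dotR x y = dotR y x :=
  sum_congr rfl fun _ _ => mul_comm _ _

lemma dotR_self_pos {x : Fin d → ℝ} (hx : x ≠ 0) : 0 < dotR x x := by
  refine lt_of_le_of_ne (sum_nonneg fun i _ => mul_self_nonneg _) fun h => hx ?_
  have := (sum_eq_zero_iff_of_nonneg fun i _ => mul_self_nonneg (x i)).1 h.symm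
  exact funext fun i => by simpa using this i (mem_univ i)

lemma continuous_dotR (y : Fin d → ℝ) : Continuous fun x => dotR y x := by
  unfold dotR
  fun_prop

/-- Inner products with finitely many linearly independent vectors can be prescribed by a vector in
their span. -/
lemma exists_combination_dotR_eq {a : Fin n → Fin d → ℝ} {I : Finset (Fin n)}
    (hI : LinearIndependent ℝ fun i : I => a i.1) (y : Fin n → ℝ) :
    ∃ μ : Fin n → ℝ, ∀ j ∈ I, dotR (a j) (∑ i ∈ I, μ i • a i) = y j := by
  let A : Matrix I (Fin d) ℝ := fun i => a i.1
  have hpos : (A * A.conjTranspose).PosDef :=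
    Matrix.PosDef.mul_conjTranspose_self A (Matrix.vecMul_injective_iff.2 hI)
  obtain ⟨ν, hν⟩ := (Matrix.mulVec_surjective_iff_isUnit.2 hpos.isUnit) fun i => y i.1
  refine ⟨fun i => if h : i ∈ I then ν ⟨i, h⟩ else 0, fun j hj => ?_⟩
  have h := congrFun hν ⟨j, hj⟩
  rw [dotR_comm, dotR_sum_left, ← h, ← Finset.sum_coe_sort]
  simp only [Matrix.mulVec, dotProduct, Matrix.mul_apply, Matrix.conjTranspose_apply, star_trivial]
  refine sum_congr rfl fun i _ => ?_
  rw [dif_pos i.2, mul_comm]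
  congr 1
  exact sum_congr rfl fun k _ => mul_comm _ _

/-- Finitely many affine hyperplanes do not cover the space. -/
lemma exists_dotR_ne {ι : Type*} [Finite ι] (e : ι → Fin d → ℝ) (β : ι → ℝ)
    (he : ∀ k, e k ≠ 0) : ∃ p : Fin d → ℝ, ∀ k, dotR (e k) p ≠ β k := by
  classical
  cases nonempty_fintype ι
  let P : ι → Polynomial ℝ := fun k =>
    (∑ i : Fin d, Polynomial.C (e k i) * Polynomial.X ^ (i.1 + 1)) - Polynomial.C (β k)
  have hP : ∀ k, P k ≠ 0 := by
    intro k hk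
    refine he k (funext fun i => ?_)
    have := congrArg (fun Q => Polynomial.coeff Q (i.1 + 1)) hk
    simpa [P, Polynomial.finsetSum_coeff, Polynomial.coeff_X_pow, Polynomial.coeff_C,
      Fin.val_inj] using this
  have hprod : ∏ k, P k ≠ 0 := prod_ne_zero_iff.2 fun k _ => hP k
  obtain ⟨t, ht⟩ := Polynomial.exists_eval_ne_zero_of_natDegree_lt_card (∏ k, P k) hprod
    ((Cardinal.natCast_lt_aleph0).trans_le (Cardinal.aleph0_le_mk ℝ))
  refine ⟨fun i => t ^ (i.1 + 1), fun k hk => ?_⟩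
  rw [Polynomial.eval_prod, prod_ne_zero_iff] at ht
  apply ht k (mem_univ k)
  simp only [dotR] at hk
  simp [P, Polynomial.eval_finsetSum, hk]

/-- The sign attached to a side of a hyperplane. -/
def sideSign (s : Bool) : ℝ := if s then 1 else -1

/-- The closed cell of the arrangement `(a, b)` with sign vector `c`. -/
def closedCell (a : Fin n → Fin d → ℝ) (b : Fin n → ℝ) (c : Fin n → Bool) : Set (Fin d → ℝ) :=
  {x | ∀ i, 0 ≤ sideSign (c i) * (dotR (a i) x - b i)}

/-- Squared Euclidean distance. -/
def sqDist (p x : Fin d → ℝ) : ℝ := dotR (x - p) (x - p)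

lemma sqDist_add_smul (p q u : Fin d → ℝ) (ε : ℝ) :
    sqDist p (q + ε • u) = sqDist p q + 2 * ε * dotR (q - p) u + ε ^ 2 * dotR u u := by
  unfold sqDist
  rw [add_sub_right_comm, dotR_add_smul, dotR_comm, dotR_add_smul, dotR_comm (q - p + ε • u) u,
    dotR_add_smul, dotR_comm u (q - p)]
  ring

variable {a : Fin n → Fin d → ℝ} {b : Fin n → ℝ}

lemma mem_inducedClass_iff {C : Finset (Fin n → Bool)} (hC : IsInducedClass a b C)
    (c : Fin n → Bool) :
    c ∈ C ↔ ∃ x, ∀ i, 0 < sideSign (c i) * (dotR (a i) x - b i) := by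
  rw [hC]
  refine exists_congr fun x => ?_
  constructor
  · rintro ⟨hx, rfl⟩ i
    rcases lt_or_gt_of_ne (hx i) with h | h
    · simp [signVec, sideSign, h.not_gt, h]
    · simp [signVec, sideSign, h]
  · intro hx
    refine ⟨fun i hi => by simpa [hi] using hx i, funext fun i => ?_⟩
    have := hx i
    cases hc : c i
    · have h : dotR (a i) x < b i := by simpa [hc, sideSign] using this
      simpa [signVec] using h.le
    · simpa [signVec, hc, sideSign] using this

lemma exists_minimizer_sqDist (p : Fin d → ℝ) (c : Fin n → Bool)
    (hne : (closedCell a b c).Nonempty) :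
    ∃ q ∈ closedCell a b c, ∀ x ∈ closedCell a b c, sqDist p q ≤ sqDist p x := by
  let e := EuclideanSpace.equiv (Fin d) ℝ
  have hclosed : IsClosed (closedCell a b c) := by
    have : closedCell a b c = ⋂ i, {x | 0 ≤ sideSign (c i) * (dotR (a i) x - b i)} := by
      ext x
      simp [closedCell]
    rw [this]
    exact isClosed_iInter fun i => isClosed_le continuous_const
      (continuous_const.mul ((continuous_dotR _).sub continuous_const))
  have hdist : ∀ x, dist (e.symm p) x ^ 2 = sqDist p (e x) := by
    intro x
    rw [dist_comm, EuclideanSpace.dist_eq, Real.sq_sqrt (sum_nonneg fun _ _ => sq_nonneg _)]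
    refine sum_congr rfl fun i _ => ?_
    rw [Real.dist_eq, sq_abs, sq]
    rfl
  obtain ⟨q, hq, hmin⟩ := (hclosed.preimage e.continuous).exists_infDist_eq_dist
    (hne.preimage e.surjective) (e.symm p)
  refine ⟨e q, hq, fun x hx => ?_⟩
  have hle : dist (e.symm p) q ≤ dist (e.symm p) (e.symm x) := by
    rw [← hmin]
    exact Metric.infDist_le_dist_of_mem (by simpa using hx)
  have := pow_le_pow_left₀ dist_nonneg hle 2
  rwa [hdist, hdist, e.apply_symm_apply] at this

lemma eventually_pos_of_ne {c : Fin n → Bool} {q : Fin d → ℝ} (hq : q ∈ closedCell a b c)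
    (u : Fin d → ℝ) {i : Fin n} (hi : dotR (a i) q ≠ b i) :
    ∀ᶠ ε in 𝓝[>] (0 : ℝ), 0 < sideSign (c i) * (dotR (a i) (q + ε • u) - b i) := by
  simp only [dotR_add_smul]
  have hpos : 0 < sideSign (c i) * (dotR (a i) q + 0 * dotR (a i) u - b i) := by
    refine lt_of_le_of_ne (by simpa using hq i) (Ne.symm (mul_ne_zero ?_ ?_))
    · unfold sideSign
      split_ifs <;> norm_num
    · simpa [sub_eq_zero] using hi
  have hcont : Continuous fun ε : ℝ =>
      sideSign (c i) * (dotR (a i) q + ε * dotR (a i) u - b i) := by fun_prop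
  exact nhdsWithin_le_nhds ((hcont.tendsto 0).eventually (lt_mem_nhds hpos))

/-- If the constraints tight at `q` are respected in direction `u`, then the cell contains an
initial piece of the ray from `q` in direction `u`. -/
lemma eventually_add_smul_mem_closedCell {c : Fin n → Bool} {q u : Fin d → ℝ}
    (hq : q ∈ closedCell a b c)
    (hu : ∀ i, dotR (a i) q = b i → 0 ≤ sideSign (c i) * dotR (a i) u) :
    ∀ᶠ ε in 𝓝[>] (0 : ℝ), q + ε • u ∈ closedCell a b c := by
  refine eventually_all.2 fun i => ?_
  by_cases hi : dotR (a i) q = b i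
  · filter_upwards [self_mem_nhdsWithin] with ε hε
    have := mul_nonneg (le_of_lt hε) (hu i hi)
    rw [dotR_add_smul, hi]
    linarith
  · filter_upwards [eventually_pos_of_ne hq u hi] with ε hε using hε.le

/-- First-order optimality of a nearest point. -/
lemma dotR_nonneg_of_isMin {p q u : Fin d → ℝ} {c : Fin n → Bool}
    (hq : q ∈ closedCell a b c) (hmin : ∀ x ∈ closedCell a b c, sqDist p q ≤ sqDist p x)
    (hu : ∀ i, dotR (a i) q = b i → 0 ≤ sideSign (c i) * dotR (a i) u) :
    0 ≤ dotR (q - p) u := by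
  have hcont : Continuous fun ε : ℝ => 2 * dotR (q - p) u + ε * dotR u u := by fun_prop
  have hlim : Tendsto (fun ε : ℝ => 2 * dotR (q - p) u + ε * dotR u u) (𝓝[>] 0)
      (𝓝 (2 * dotR (q - p) u + 0 * dotR u u)) :=
    (hcont.tendsto 0).mono_left nhdsWithin_le_nhds
  have := ge_of_tendsto hlim (b := 0) <| by
    filter_upwards [eventually_add_smul_mem_closedCell hq hu, self_mem_nhdsWithin] with ε hε hpos
    have h := hmin _ hε
    rw [sqDist_add_smul] at h
    refine nonneg_of_mul_nonneg_right (a := ε) ?_ hpos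
    linarith
  linarith

/-- The hyperplanes of the arrangement through `q`. -/
noncomputable def tightSet (a : Fin n → Fin d → ℝ) (b : Fin n → ℝ) (q : Fin d → ℝ) :
    Finset (Fin n) :=
  univ.filter fun i => dotR (a i) q = b i

lemma mem_tightSet {q : Fin d → ℝ} {i : Fin n} : i ∈ tightSet a b q ↔ dotR (a i) q = b i := by
  simp [tightSet]

lemma card_tightSet_le (hA : SimpleArrangement d a b) (q : Fin d → ℝ) :
    (tightSet a b q).card ≤ d := by
  by_contra! h
  obtain ⟨S, hS, hcard⟩ := exists_subset_card_eq (Nat.succ_le_of_lt h)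
  exact hA.2 S hcard ⟨q, fun i hi => mem_tightSet.1 (hS hi)⟩

lemma mem_closedCell_of_agree_compl {c c' : Fin n → Bool} {q : Fin d → ℝ}
    (hq : q ∈ closedCell a b c) (hc : ∀ i, i ∉ tightSet a b q → c' i = c i) :
    q ∈ closedCell a b c' := by
  intro i
  by_cases hi : i ∈ tightSet a b q
  · simp [mem_tightSet.1 hi]
  · rw [hc i hi]
    exact hq i

/-- Around `q`, all sign patterns on the hyperplanes through `q` are realized. -/
lemma exists_pos_of_agree_compl (hA : SimpleArrangement d a b) {c c' : Fin n → Bool}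
    {q : Fin d → ℝ} (hq : q ∈ closedCell a b c) (hc : ∀ i, i ∉ tightSet a b q → c' i = c i) :
    ∃ x, ∀ i, 0 < sideSign (c' i) * (dotR (a i) x - b i) := by
  obtain ⟨μ, hμ⟩ := exists_combination_dotR_eq (hA.1 _ (card_tightSet_le hA q))
    fun i => sideSign (c' i)
  set u := ∑ i ∈ tightSet a b q, μ i • a i
  have key : ∀ᶠ ε in 𝓝[>] (0 : ℝ), ∀ i,
      0 < sideSign (c' i) * (dotR (a i) (q + ε • u) - b i) := by
    refine eventually_all.2 fun i => ?_
    by_cases hi : i ∈ tightSet a b q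
    · filter_upwards [self_mem_nhdsWithin] with ε hε
      have hε : 0 < ε := hε
      rw [dotR_add_smul, hμ i hi, mem_tightSet.1 hi]
      unfold sideSign
      split_ifs <;> linarith
    · exact eventually_pos_of_ne (mem_closedCell_of_agree_compl hq hc) u
        (mt mem_tightSet.2 hi)
  obtain ⟨ε, hε⟩ := key.exists
  exact ⟨_, hε⟩

/-- The nearest point of a cell is strictly closer than any other point lying on the same sides of
the hyperplanes through it. -/
lemma sqDist_lt_of_agree {p q x : Fin d → ℝ} {c : Fin n → Bool}
    (hq : q ∈ closedCell a b c) (hmin : ∀ x ∈ closedCell a b c, sqDist p q ≤ sqDist p x)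
    (hx : ∀ i ∈ tightSet a b q, 0 ≤ sideSign (c i) * (dotR (a i) x - b i)) (hne : x ≠ q) :
    sqDist p q < sqDist p x := by
  have hsub : ∀ y, dotR y (x - q) = dotR y x - dotR y q := by
    intro y
    have h := dotR_add_smul y q (x - q) 1
    rw [one_smul, add_sub_cancel] at h
    linarith
  have h := dotR_nonneg_of_isMin (p := p) (u := x - q) hq hmin fun i hi => by
    rw [hsub, hi]
    exact hx i (mem_tightSet.2 hi)
  have h2 := sqDist_add_smul p q (x - q) 1
  rw [one_smul, add_sub_cancel] at h2
  have := dotR_self_pos (sub_ne_zero.2 hne)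
  linarith

/-- For a generic base point `p`, a point `q` is the nearest point to `p` of at most one of the
cells around `q`. -/
lemma exists_generic_point (hA : SimpleArrangement d a b) :
    ∃ p : Fin d → ℝ, ∀ q (c c' : Fin n → Bool), q ∈ closedCell a b c → q ∈ closedCell a b c' →
      (∀ x ∈ closedCell a b c, sqDist p q ≤ sqDist p x) →
      (∀ x ∈ closedCell a b c', sqDist p q ≤ sqDist p x) →
      (∀ i, i ∉ tightSet a b q → c' i = c i) → c' = c := by
  let ι := {s : Finset (Fin n) × Fin n // s.1.card ≤ d ∧ s.2 ∈ s.1}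
  have hdual : ∀ s : ι, ∃ μ : Fin n → ℝ, ∀ i ∈ s.1.1,
      dotR (a i) (∑ k ∈ s.1.1, μ k • a k) = if i = s.1.2 then 1 else 0 := fun s =>
    exists_combination_dotR_eq (hA.1 _ s.2.1) fun i => if i = s.1.2 then 1 else 0
  choose μ hμ using hdual
  obtain ⟨p, hp⟩ := exists_dotR_ne (fun s : ι => ∑ k ∈ s.1.1, μ s k • a k)
    (fun s => ∑ k ∈ s.1.1, μ s k * b k) fun s h0 => by
      have h := hμ s s.1.2 s.2.2
      rw [h0] at h
      simp [dotR] at h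
  refine ⟨p, fun q c c' hq hq' hmin hmin' hag => ?_⟩
  by_contra hne
  obtain ⟨j, hj⟩ := Function.ne_iff.1 hne
  have hjT : j ∈ tightSet a b q := by
    by_contra h
    exact hj (hag j h)
  let s : ι := ⟨(tightSet a b q, j), card_tightSet_le hA q, hjT⟩
  set e := ∑ k ∈ tightSet a b q, μ s k • a k with he
  have hae : ∀ i, dotR (a i) q = b i → dotR (a i) e = if i = j then 1 else 0 :=
    fun i hi => hμ s i (mem_tightSet.2 hi)
  have hsmul : ∀ y (r : ℝ), dotR y (r • e) = r * dotR y e := by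
    intro y r
    simp only [dotR, Pi.smul_apply, smul_eq_mul, mul_sum]
    exact sum_congr rfl fun i _ => by ring
  have hside : ∀ c : Fin n → Bool, q ∈ closedCell a b c →
      (∀ x ∈ closedCell a b c, sqDist p q ≤ sqDist p x) →
      0 ≤ sideSign (c j) * dotR (q - p) e := by
    intro c hq hmin
    rw [← hsmul]
    refine dotR_nonneg_of_isMin hq hmin fun i hi => ?_
    rw [hsmul, hae i hi]
    split_ifs with hij
    · rw [hij, mul_one]
      exact mul_self_nonneg _
    · simp
  have hzero : dotR (q - p) e = 0 := by
    have h1 := hside c hq hmin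
    have h2 := hside c' hq' hmin'
    unfold sideSign at h1 h2
    cases h : c j <;> cases h' : c' j <;> simp_all <;> linarith
  apply hp s
  have hqe : dotR e q = ∑ k ∈ tightSet a b q, μ s k * b k := by
    rw [he, dotR_sum_left]
    exact sum_congr rfl fun k hk => by rw [mem_tightSet.1 hk]
  have hpe : dotR e q - dotR e p = dotR (q - p) e := by
    simp only [dotR, ← sum_sub_distrib, Pi.sub_apply]
    exact sum_congr rfl fun i _ => by ring
  change dotR e p = ∑ k ∈ tightSet a b q, μ s k * b k
  linarith

end Geometry

/-- Any `d`-maximum class induced by a simple linear arrangement of `n`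
hyperplanes in `ℝ^d` (`n ≥ d ≥ 1`) can be `d`-corner-peeled, and the resulting
corner-peeling yields an unlabeled compression scheme of size `d`. -/
theorem stmt9 (d n : ℕ) (hd : 1 ≤ d) (hdn : d ≤ n)
    (a : Fin n → Fin d → ℝ) (b : Fin n → ℝ) (hA : SimpleArrangement d a b)
    (C : Finset (Fin n → Bool)) (hC : IsInducedClass a b C) (hmax : IsMaximum C d) :
    ∃ v : Fin C.card → (Fin n → Bool),
      IsCornerPeeling C v ∧
      (∀ t, degreeIn (Peeled C v t) (v t) ≤ d) ∧
      (Function.Injective fun t => incidentColors (Peeled C v t) (v t)) ∧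
      (∀ I : Finset (Fin n), I.card ≤ d ↔ ∃ t, incidentColors (Peeled C v t) (v t) = I) ∧
      (∀ s t : Fin C.card, s ≠ t →
        ∃ i ∈ incidentColors (Peeled C v s) (v s) ∪ incidentColors (Peeled C v t) (v t),
          v s i ≠ v t i) := by
  classical
  obtain ⟨p, hp⟩ := exists_generic_point hA
  have hnear : ∀ c, ∃ q, c ∈ C → q ∈ closedCell a b c ∧
      ∀ x ∈ closedCell a b c, sqDist p q ≤ sqDist p x := by
    intro c
    by_cases hc : c ∈ C
    · obtain ⟨x, hx⟩ := (mem_inducedClass_iff hC c).1 hc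
      obtain ⟨q, hq⟩ := exists_minimizer_sqDist p c ⟨x, fun i => (hx i).le⟩
      exact ⟨q, fun _ => hq⟩
    · exact ⟨0, fun h => absurd h hc⟩
  choose q hq using hnear
  refine exists_cornerPeeling_of_potential C hmax.2 (fun c => sqDist p (q c))
    (fun c => tightSet a b (q c)) (fun c _ => card_tightSet_le hA _) ?_ ?_
  · intro c hc c' hc' hag hne
    obtain ⟨hqc, hmin⟩ := hq c hc
    obtain ⟨hqc', -⟩ := hq c' hc'
    refine sqDist_lt_of_agree hqc hmin (fun i hi => hag i hi ▸ hqc' i) fun heq => ?_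
    obtain ⟨j, hj⟩ := Function.ne_iff.1 hne
    refine hj (hag j (mem_tightSet.2 ?_))
    have h1 := hqc j
    have h2 := hqc' j
    rw [heq] at h2
    unfold sideSign at h1 h2
    cases h : c j <;> cases h' : c' j <;> simp_all <;> linarith
  · intro c hc c' hag hne
    obtain ⟨hqc, hmin⟩ := hq c hc
    have hc' : c' ∈ C := (mem_inducedClass_iff hC c').2 (exists_pos_of_agree_compl hA hqc hag)
    obtain ⟨-, hmin'⟩ := hq c' hc'
    have hqc' := mem_closedCell_of_agree_compl hqc hag
    refine ⟨hc', lt_of_le_of_ne (hmin' _ hqc') fun heq => hne ?_⟩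
    exact hp _ c c' hqc hqc' hmin (fun x hx => heq ▸ hmin' x hx) hag

end GeomCompress
end

section
/- Any d-maximum class C ⊆ {0,1}^n induced by a simple linear arrangement of n hyperplanes in ℝ^d (n ≥ d ≥ 1) admits a corner-peeling ordering v_1,…,v_{|C|} in which the dimensions of the unique maximal cubes C'_{t−1} removed at the successive steps are non-increasing in t; moreover, for each 0 ≤ i ≤ d, exactly binom(n, d−i) of the removed cubes have dimension d−i. -/
open Finset

namespace GeomCompress

/-- The sign `±1` encoded by a Boolean. -/
def boolSign (s : Bool) : ℝ := if s then 1 else -1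

lemma boolSign_mul_self (s : Bool) : boolSign s * boolSign s = 1 := by
  cases s <;> simp [boolSign]

lemma boolSign_ne_zero (s : Bool) : boolSign s ≠ 0 := by
  cases s <;> simp [boolSign]

lemma boolSign_mul_pos_iff {s : Bool} {r : ℝ} (hr : r ≠ 0) :
    0 < boolSign s * r ↔ s = decide (0 < r) := by
  rcases lt_or_gt_of_ne hr with h | h <;> cases s <;> simp [boolSign, h, h.le]

lemma boolSign_not (s : Bool) : boolSign (!s) = -boolSign s := by
  cases s <;> simp [boolSign]

section Arrangement

variable {ι V : Type} [AddCommGroup V] [Module ℝ V]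

/-- The closed region with sign vector `c`. -/
def InClosedCell (a : ι → Module.Dual ℝ V) (b : ι → ℝ) (c : ι → Bool) (x : V) : Prop :=
  ∀ i, 0 ≤ boolSign (c i) * (a i x - b i)

/-- The open region with sign vector `c`. -/
def InOpenCell (a : ι → Module.Dual ℝ V) (b : ι → ℝ) (c : ι → Bool) (x : V) : Prop :=
  ∀ i, 0 < boolSign (c i) * (a i x - b i)

lemma InOpenCell.inClosedCell {a : ι → Module.Dual ℝ V} {b : ι → ℝ} {c : ι → Bool} {x : V}
    (h : InOpenCell a b c x) : InClosedCell a b c x := fun i => (h i).le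

/-- A simple arrangement of affine hyperplanes `a i x = b i` in a finite-dimensional space. -/
structure IsSimple [Fintype ι] (a : ι → Module.Dual ℝ V) (b : ι → ℝ) : Prop where
  inj : ∀ S : Finset ι, S.card = Module.finrank ℝ V → ∀ x, (∀ i ∈ S, a i x = 0) → x = 0
  empty : ∀ S : Finset ι, S.card = Module.finrank ℝ V + 1 → ∀ x, ∃ i ∈ S, a i x ≠ b i
  card_le : Module.finrank ℝ V ≤ Fintype.card ι

open Classical in
/-- A solution of the system `a i x = y i`, `i ∈ S`, when there is one. -/
noncomputable def solve (a : ι → Module.Dual ℝ V) (S : Finset ι) (y : ι → ℝ) : V :=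
  if h : ∃ x, ∀ i ∈ S, a i x = y i then h.choose else 0

/-- The common point of the hyperplanes in `S`. -/
noncomputable def vertex (a : ι → Module.Dual ℝ V) (b : ι → ℝ) (S : Finset ι) : V :=
  solve a S b

/-- The direction, dual to `a i`, of the line in which the hyperplanes in `S \ {i}` meet. -/
noncomputable def edge [DecidableEq ι] (a : ι → Module.Dual ℝ V) (S : Finset ι) (i : ι) : V :=
  solve a S (Pi.single i 1)

/-- The region on which `f` attains its maximum at the vertex of `S`. -/
noncomputable def topCell [DecidableEq ι] (a : ι → Module.Dual ℝ V) (b : ι → ℝ)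
    (f : Module.Dual ℝ V) (S : Finset ι) : ι → Bool :=
  fun i => if i ∈ S then decide (0 < -f (edge a S i)) else decide (0 < a i (vertex a b S) - b i)

/-- `f` is not constant along any line of the arrangement. -/
def IsGeneric [DecidableEq ι] (a : ι → Module.Dual ℝ V) (f : Module.Dual ℝ V) : Prop :=
  ∀ S : Finset ι, S.card = Module.finrank ℝ V → ∀ i ∈ S, f (edge a S i) ≠ 0

variable [Fintype ι] [DecidableEq ι] [FiniteDimensional ℝ V]
  {a : ι → Module.Dual ℝ V} {b : ι → ℝ} {c : ι → Bool} {f : Module.Dual ℝ V} {S T E : Finset ι}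

omit [DecidableEq ι] in
lemma IsSimple.solve_spec (h : IsSimple a b) (hS : S.card = Module.finrank ℝ V) (y : ι → ℝ) :
    ∀ i ∈ S, a i (solve a S y) = y i := by
  have hex : ∃ x, ∀ i ∈ S, a i x = y i := by
    let L : V →ₗ[ℝ] (S → ℝ) := LinearMap.pi fun i => a i.1
    have hinj : Function.Injective L := by
      rw [← LinearMap.ker_eq_bot, LinearMap.ker_eq_bot']
      intro x hx
      exact h.inj S hS x fun i hi => congrFun hx ⟨i, hi⟩
    have hsurj : Function.Surjective L :=
      (LinearMap.injective_iff_surjective_of_finrank_eq_finrank (by simp [hS])).1 hinj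
    obtain ⟨x, hx⟩ := hsurj fun i => y i.1
    exact ⟨x, fun i hi => congrFun hx ⟨i, hi⟩⟩
  rw [solve, dif_pos hex]
  exact hex.choose_spec

omit [DecidableEq ι] in
lemma IsSimple.vertex_spec (h : IsSimple a b) (hS : S.card = Module.finrank ℝ V) :
    ∀ i ∈ S, a i (vertex a b S) = b i := h.solve_spec hS b

lemma IsSimple.edge_spec (h : IsSimple a b) (hS : S.card = Module.finrank ℝ V) (i : ι) :
    ∀ j ∈ S, a j (edge a S i) = (Pi.single i 1 : ι → ℝ) j := h.solve_spec hS _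

omit [DecidableEq ι] in
lemma IsSimple.eq_vertex (h : IsSimple a b) (hS : S.card = Module.finrank ℝ V) {x : V}
    (hx : ∀ i ∈ S, a i x = b i) : x = vertex a b S := by
  rw [← sub_eq_zero]
  refine h.inj S hS _ fun i hi => ?_
  rw [map_sub, hx i hi, h.vertex_spec hS i hi, sub_self]

omit [DecidableEq ι] [FiniteDimensional ℝ V] in
lemma IsSimple.card_active_le (h : IsSimple a b) {x : V} (hS : ∀ i ∈ S, a i x = b i) :
    S.card ≤ Module.finrank ℝ V := by
  by_contra! hlt
  obtain ⟨T, hTS, hT⟩ := Finset.exists_subset_card_eq (Nat.succ_le_of_lt hlt)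
  obtain ⟨i, hi, hne⟩ := h.empty T hT x
  exact hne (hS i (hTS hi))

lemma IsSimple.vertex_ne (h : IsSimple a b) (hS : S.card = Module.finrank ℝ V) {i : ι}
    (hi : i ∉ S) : a i (vertex a b S) - b i ≠ 0 := by
  intro h0
  have := h.card_active_le (S := insert i S) (x := vertex a b S) (by
    intro j hj
    rcases Finset.mem_insert.1 hj with rfl | hj
    · exact sub_eq_zero.1 h0
    · exact h.vertex_spec hS j hj)
  rw [Finset.card_insert_of_notMem hi] at this
  omega

lemma IsSimple.eq_of_vertex_mem (h : IsSimple a b) (hS : S.card = Module.finrank ℝ V)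
    (hT : T.card = Module.finrank ℝ V) (hv : ∀ i ∈ T, a i (vertex a b S) = b i) : T = S := by
  refine Finset.eq_of_subset_of_card_le (fun i hi => ?_) (by omega)
  by_contra hiS
  exact h.vertex_ne hS hiS (sub_eq_zero.2 (hv i hi))

lemma IsSimple.expand_linear (h : IsSimple a b) (hS : S.card = Module.finrank ℝ V) (x : V) :
    x = ∑ i ∈ S, a i x • edge a S i := by
  rw [← sub_eq_zero]
  refine h.inj S hS _ fun j hj => ?_
  rw [map_sub, map_sum, Finset.sum_eq_single j]
  · simp [h.edge_spec hS j j hj]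
  · intro i _ hij
    simp [h.edge_spec hS i j hj, hij.symm]
  · exact fun hn => absurd hj hn

lemma IsSimple.expand (h : IsSimple a b) (hS : S.card = Module.finrank ℝ V)
    (f : Module.Dual ℝ V) (x : V) :
    f x = f (vertex a b S) + ∑ i ∈ S, f (edge a S i) * (a i x - b i) := by
  have := congrArg f (h.expand_linear hS (x - vertex a b S))
  rw [map_sub, map_sum] at this
  rw [← sub_eq_iff_eq_add', this]
  refine Finset.sum_congr rfl fun i hi => ?_
  rw [map_smul, map_sub, h.vertex_spec hS i hi, smul_eq_mul, mul_comm]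

omit [FiniteDimensional ℝ V] [Fintype ι] in
lemma boolSign_topCell_mul_edge {i : ι} (hi : i ∈ S) (hne : f (edge a S i) ≠ 0) :
    boolSign (topCell a b f S i) * f (edge a S i) < 0 := by
  have := (boolSign_mul_pos_iff (s := topCell a b f S i) (neg_ne_zero.2 hne)).2 (by
    simp [topCell, hi])
  linarith

lemma IsSimple.eq_topCell (h : IsSimple a b) (hS : S.card = Module.finrank ℝ V)
    (hv : InClosedCell a b c (vertex a b S))
    (hc : ∀ i ∈ S, boolSign (c i) * f (edge a S i) < 0) : c = topCell a b f S := by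
  funext i
  by_cases hi : i ∈ S
  · have h1 := hc i hi
    have hne : f (edge a S i) ≠ 0 := by rintro h0; simp [h0] at h1
    simp only [topCell, hi, if_true]
    rw [← boolSign_mul_pos_iff (neg_ne_zero.2 hne)]
    linarith
  · simp only [topCell, hi, if_false]
    have hne := h.vertex_ne hS hi
    rw [← boolSign_mul_pos_iff hne]
    exact lt_of_le_of_ne (hv i) (Ne.symm (mul_ne_zero (boolSign_ne_zero _) hne))

lemma IsSimple.le_vertex (h : IsSimple a b) (hf : IsGeneric a f)
    (hS : S.card = Module.finrank ℝ V) {x : V}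
    (hx : InClosedCell a b (topCell a b f S) x) : f x ≤ f (vertex a b S) := by
  rw [h.expand hS f x]
  have : ∑ i ∈ S, f (edge a S i) * (a i x - b i) ≤ 0 := by
    refine Finset.sum_nonpos fun i hi => ?_
    have h1 := boolSign_topCell_mul_edge (b := b) hi (hf S hS i hi)
    nlinarith [mul_nonneg (neg_nonneg.2 h1.le) (hx i), boolSign_mul_self (topCell a b f S i)]
  linarith

lemma IsSimple.vertex_eq_of_le (h : IsSimple a b) (hf : IsGeneric a f)
    (hS : S.card = Module.finrank ℝ V) {x : V}
    (hx : InClosedCell a b (topCell a b f S) x) (hle : f (vertex a b S) ≤ f x) :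
    x = vertex a b S := by
  have hterm : ∀ i ∈ S, f (edge a S i) * (a i x - b i) ≤ 0 := by
    intro i hi
    have h1 := boolSign_topCell_mul_edge (b := b) hi (hf S hS i hi)
    nlinarith [mul_nonneg (neg_nonneg.2 h1.le) (hx i), boolSign_mul_self (topCell a b f S i)]
  have hsum : ∑ i ∈ S, f (edge a S i) * (a i x - b i) = 0 := by
    refine le_antisymm (Finset.sum_nonpos hterm) ?_
    have := h.expand hS f x
    linarith
  refine h.eq_vertex hS fun i hi => ?_
  have := (Finset.sum_eq_zero_iff_of_nonpos hterm).1 hsum i hi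
  exact sub_eq_zero.1 ((mul_eq_zero.1 this).resolve_left (hf S hS i hi))

omit [DecidableEq ι] [FiniteDimensional ℝ V] in
lemma eventually_pos_of_pos (x u : V) :
    ∀ᶠ t : ℝ in nhdsWithin 0 (Set.Ioi 0), ∀ i, 0 < boolSign (c i) * (a i x - b i) →
      0 < boolSign (c i) * (a i (x + t • u) - b i) := by
  rw [Filter.eventually_all]
  intro i
  by_cases hi : 0 < boolSign (c i) * (a i x - b i)
  · have hcont : Continuous fun t : ℝ => boolSign (c i) * (a i x + t * a i u - b i) := by fun_prop
    have := (hcont.tendsto 0).mono_left (nhdsWithin_le_nhds (s := Set.Ioi 0))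
    filter_upwards [this.eventually_const_lt (u := 0) (by simpa using hi)] with t ht _
    simpa using ht
  · exact Filter.Eventually.of_forall fun t h => absurd h hi

omit [DecidableEq ι] [FiniteDimensional ℝ V] in
lemma exists_pos_inClosedCell {x : V} (hx : InClosedCell a b c x) (u : V)
    (hu : ∀ i, a i x = b i → 0 ≤ boolSign (c i) * a i u) :
    ∃ t : ℝ, 0 < t ∧ InClosedCell a b c (x + t • u) := by
  obtain ⟨t, ht, ht0⟩ := ((eventually_pos_of_pos (a := a) (b := b) (c := c) x u).and
    self_mem_nhdsWithin).exists
  refine ⟨t, ht0, fun i => ?_⟩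
  rcases (hx i).lt_or_eq with hi | hi
  · exact (ht i hi).le
  · have hb : a i x = b i :=
      sub_eq_zero.1 ((mul_eq_zero.1 hi.symm).resolve_left (boolSign_ne_zero _))
    have h2 := mul_nonneg (le_of_lt ht0) (hu i hb)
    simp only [map_add, map_smul, smul_eq_mul, hb]
    linarith

lemma exists_inOpenCell_of_vertex (h : IsSimple a b) (hS : S.card = Module.finrank ℝ V)
    (hc : ∀ i ∉ S, 0 < boolSign (c i) * (a i (vertex a b S) - b i)) :
    ∃ x, InOpenCell a b c x := by
  set u := solve a S fun i => boolSign (c i)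
  obtain ⟨t, ht, ht0⟩ := ((eventually_pos_of_pos (a := a) (b := b) (c := c) (vertex a b S) u).and
    self_mem_nhdsWithin).exists
  refine ⟨vertex a b S + t • u, fun i => ?_⟩
  by_cases hi : i ∈ S
  · have h1 : a i u = boolSign (c i) := h.solve_spec hS _ i hi
    simp only [map_add, map_smul, smul_eq_mul, h.vertex_spec hS i hi, h1]
    have := boolSign_mul_self (c i)
    have ht0' : (0 : ℝ) < t := ht0
    nlinarith
  · exact ht i (hc i hi)

omit [DecidableEq ι] [FiniteDimensional ℝ V] in
/-- Moving in the direction `u` until the first new hyperplane is hit. -/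
lemma exists_hit {x u : V} (hx : InClosedCell a b c x) (hu : ∀ i, a i x = b i → a i u = 0)
    (hneg : ∃ j, boolSign (c j) * a j u < 0) :
    ∃ t : ℝ, 0 ≤ t ∧ InClosedCell a b c (x + t • u) ∧
      ∃ j, a j x ≠ b j ∧ a j (x + t • u) = b j := by
  obtain ⟨j₀, hj₀⟩ := hneg
  obtain ⟨j, hj, hmin⟩ := (Finset.univ.filter fun j => boolSign (c j) * a j u < 0).exists_min_image
    (fun j => (boolSign (c j) * (a j x - b j)) / (-(boolSign (c j) * a j u)))
    ⟨j₀, by simpa using hj₀⟩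
  simp only [Finset.mem_filter, Finset.mem_univ, true_and] at hj hmin
  set t := (boolSign (c j) * (a j x - b j)) / (-(boolSign (c j) * a j u))
  have ht0 : 0 ≤ t := div_nonneg (hx j) (by linarith)
  have hmul : t * (-(boolSign (c j) * a j u)) = boolSign (c j) * (a j x - b j) :=
    div_mul_cancel₀ _ (by linarith)
  refine ⟨t, ht0, fun i => ?_, j, fun hb => ?_, ?_⟩
  · simp only [map_add, map_smul, smul_eq_mul]
    by_cases hi : boolSign (c i) * a i u < 0
    · have := hmin i hi
      rw [le_div_iff₀ (by linarith)] at this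
      linarith
    · have := mul_nonneg ht0 (not_lt.1 hi)
      have := hx i
      linarith
  · simp [hu j hb] at hj
  · simp only [map_add, map_smul, smul_eq_mul]
    have h1 := boolSign_mul_self (c j)
    have h2 : boolSign (c j) * (boolSign (c j) * (a j x + t * a j u - b j)) = 0 := by
      rw [show boolSign (c j) * (a j x + t * a j u - b j) = 0 by linarith, mul_zero]
    rw [← mul_assoc, h1, one_mul] at h2
    linarith

/-- A linear functional bounded above on a face of a closed region is, at each point of the face,
dominated by its value at some vertex of that face. -/
lemma IsSimple.exists_vertex_ge (h : IsSimple a b) {x₀ : V} (hx₀ : InClosedCell a b c x₀)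
    (hE : ∀ i ∈ E, a i x₀ = b i) {B : ℝ}
    (hB : ∀ x, InClosedCell a b c x → (∀ i ∈ E, a i x = b i) → f x ≤ B) :
    ∃ S : Finset ι, S.card = Module.finrank ℝ V ∧ E ⊆ S ∧ InClosedCell a b c (vertex a b S) ∧
      f x₀ ≤ f (vertex a b S) := by
  let P : Finset ι → Prop := fun S => ∃ x, InClosedCell a b c x ∧ E ⊆ S ∧ f x₀ ≤ f x ∧
    ∀ i, i ∈ S ↔ a i x = b i
  classical
  obtain ⟨S, hS, hmax⟩ := (Finset.univ.filter P).exists_max_image Finset.card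
    ⟨Finset.univ.filter fun i => a i x₀ = b i, by
      simp only [Finset.mem_filter, Finset.mem_univ, true_and]
      exact ⟨x₀, hx₀, fun i hi => by simpa using hE i hi, le_rfl, by simp⟩⟩
  simp only [Finset.mem_filter, Finset.mem_univ, true_and] at hS hmax
  obtain ⟨x, hx, hES, hfx, hact⟩ := hS
  have hcard : S.card = Module.finrank ℝ V := by
    refine le_antisymm (h.card_active_le fun i hi => (hact i).1 hi) ?_
    by_contra! hlt
    have hstep : ∀ u : V, (∀ i ∈ S, a i u = 0) → 0 ≤ f u →
        (∃ j, boolSign (c j) * a j u < 0) → False := by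
      intro u hu hfu hneg
      obtain ⟨t, ht0, hcl, j, hj, hj'⟩ := exists_hit hx (fun i hi => hu i ((hact i).2 hi)) hneg
      have hact' : ∀ i ∈ S, a i (x + t • u) = b i := fun i hi => by
        simp [hu i hi, (hact i).1 hi]
      have hP := hmax (Finset.univ.filter fun i => a i (x + t • u) = b i)
        ⟨x + t • u, hcl, fun i hi => by simpa using hact' i (hES hi), by
          have := mul_nonneg ht0 hfu
          simp only [map_add, map_smul, smul_eq_mul]
          linarith, by simp⟩
      have hsub : insert j S ⊆ Finset.univ.filter fun i => a i (x + t • u) = b i := by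
        intro i hi
        rcases Finset.mem_insert.1 hi with rfl | hi
        · simpa using hj'
        · simpa using hact' i hi
      have := Finset.card_le_card hsub
      rw [Finset.card_insert_of_notMem fun hjS => hj ((hact j).1 hjS)] at this
      omega
    obtain ⟨u, hu0, hu⟩ : ∃ u : V, u ≠ 0 ∧ ∀ i ∈ S, a i u = 0 := by
      let L : V →ₗ[ℝ] (S → ℝ) := LinearMap.pi fun i => a i.1
      have hk : LinearMap.ker L ≠ ⊥ := LinearMap.ker_ne_bot_of_finrank_lt (by simpa using hlt)
      obtain ⟨u, hu, hu0⟩ := Submodule.exists_mem_ne_zero_of_ne_bot hk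
      exact ⟨u, hu0, fun i hi => congrFun (LinearMap.mem_ker.1 hu) ⟨i, hi⟩⟩
    have hup : ∀ u : V, (∀ i ∈ S, a i u = 0) → 0 < f u → False := by
      intro u hu hfu
      refine hstep u hu hfu.le ?_
      by_contra! hpos
      have hf' := hB (x + ((|B| + |f x| + 1) / f u) • u) (fun i => by
        have h1 := mul_nonneg (show 0 ≤ (|B| + |f x| + 1) / f u by positivity) (hpos i)
        have h2 := hx i
        simp only [map_add, map_smul, smul_eq_mul]
        linarith) (fun i hi => by simp [hu i (hES hi), (hact i).1 (hES hi)])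
      simp only [map_add, map_smul, smul_eq_mul, div_mul_cancel₀ _ hfu.ne'] at hf'
      have := le_abs_self B
      have := neg_abs_le (f x)
      linarith
    have hneg : ∀ i ∈ S, a i (-u) = 0 := fun i hi => by simp [hu i hi]
    have hfu : f u = 0 := by
      rcases lt_trichotomy (f u) 0 with hlt | heq | hgt
      · exact (hup (-u) hneg (by simpa using hlt)).elim
      · exact heq
      · exact (hup u hu hgt).elim
    obtain ⟨T, -, hT⟩ := Finset.exists_subset_card_eq (s := (Finset.univ : Finset ι))
      (by simpa using h.card_le)
    obtain ⟨j, hj⟩ : ∃ j, a j u ≠ 0 := by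
      by_contra! hall
      exact hu0 (h.inj T hT u fun i _ => hall i)
    have hj' : boolSign (c j) * a j u ≠ 0 := mul_ne_zero (boolSign_ne_zero _) hj
    rcases lt_or_gt_of_ne hj' with hlt | hgt
    · exact hstep u hu hfu.ge ⟨j, hlt⟩
    · exact hstep (-u) hneg (by simp [hfu]) ⟨j, by simpa using hgt⟩
  have hxv := h.eq_vertex hcard fun i hi => (hact i).1 hi
  exact ⟨S, hcard, hES, hxv ▸ hx, hxv ▸ hfx⟩

/-- Optimality conditions at a vertex maximizing `f` over a face of a closed region. -/
lemma IsSimple.exists_optimal_vertex (h : IsSimple a b) (hf : IsGeneric a f) {x₀ : V}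
    (hx₀ : InClosedCell a b c x₀) (hE : ∀ i ∈ E, a i x₀ = b i) {B : ℝ}
    (hB : ∀ x, InClosedCell a b c x → (∀ i ∈ E, a i x = b i) → f x ≤ B) :
    ∃ S : Finset ι, S.card = Module.finrank ℝ V ∧ E ⊆ S ∧ InClosedCell a b c (vertex a b S) ∧
      ∀ i ∈ S, i ∉ E → boolSign (c i) * f (edge a S i) < 0 := by
  classical
  obtain ⟨S₀, h₁, h₂, h₃, -⟩ := h.exists_vertex_ge hx₀ hE hB
  obtain ⟨S, hS, hmax⟩ := (Finset.univ.filter fun S : Finset ι => S.card = Module.finrank ℝ V ∧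
    E ⊆ S ∧ InClosedCell a b c (vertex a b S)).exists_max_image (fun S => f (vertex a b S))
    ⟨S₀, by simp [h₁, h₂, h₃]⟩
  simp only [Finset.mem_filter, Finset.mem_univ, true_and] at hS hmax
  obtain ⟨hcard, hES, hcl⟩ := hS
  refine ⟨S, hcard, hES, hcl, fun i hi hiE => ?_⟩
  by_contra! hge
  have hgt := lt_of_le_of_ne hge (Ne.symm (mul_ne_zero (boolSign_ne_zero _) (hf S hcard i hi)))
  have hau : ∀ j ∈ S, a j (boolSign (c i) • edge a S i) =
      boolSign (c i) * (Pi.single i 1 : ι → ℝ) j := fun j hj => by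
    simp [h.edge_spec hcard i j hj]
  obtain ⟨t, ht, hcl'⟩ := exists_pos_inClosedCell hcl (boolSign (c i) • edge a S i) (by
    intro j hj
    have hjS : j ∈ S := by
      by_contra hjS
      exact h.vertex_ne hcard hjS (sub_eq_zero.2 hj)
    rw [hau j hjS]
    by_cases hji : j = i
    · subst hji
      simp [boolSign_mul_self]
    · simp [hji])
  obtain ⟨S', k₁, k₂, k₃, k₄⟩ := h.exists_vertex_ge hcl' (fun j hj => by
    have hji : j ≠ i := fun hji => hiE (hji ▸ hj)
    rw [map_add, map_smul, hau j (hES hj), h.vertex_spec hcard j (hES hj)]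
    simp [hji]) hB
  have := hmax S' ⟨k₁, k₂, k₃⟩
  simp only [map_add, map_smul, smul_eq_mul] at k₄
  have := mul_pos ht hgt
  linarith

lemma IsSimple.pos_of_eq_topCell (h : IsSimple a b) (hS : S.card = Module.finrank ℝ V)
    (hc : ∀ i ∉ S, c i = topCell a b f S i) :
    ∀ i ∉ S, 0 < boolSign (c i) * (a i (vertex a b S) - b i) := by
  intro i hi
  rw [boolSign_mul_pos_iff (h.vertex_ne hS hi), hc i hi]
  simp [topCell, hi]

lemma IsSimple.vertex_inClosedCell (h : IsSimple a b) (hS : S.card = Module.finrank ℝ V)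
    (hc : ∀ i ∉ S, c i = topCell a b f S i) : InClosedCell a b c (vertex a b S) := by
  intro i
  by_cases hi : i ∈ S
  · simp [h.vertex_spec hS i hi]
  · exact (h.pos_of_eq_topCell hS hc i hi).le

lemma IsSimple.eq_of_vertex_eq (h : IsSimple a b) (hS : S.card = Module.finrank ℝ V)
    (hT : T.card = Module.finrank ℝ V) (hv : vertex a b S = vertex a b T) : S = T :=
  (h.eq_of_vertex_mem hS hT fun i hi => hv ▸ h.vertex_spec hT i hi).symm

lemma IsSimple.lt_of_agree (h : IsSimple a b) (hf : IsGeneric a f)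
    (hS : S.card = Module.finrank ℝ V) (hT : T.card = Module.finrank ℝ V) (hne : S ≠ T)
    (hc : ∀ i ∉ S, topCell a b f T i = topCell a b f S i) :
    f (vertex a b S) < f (vertex a b T) := by
  by_contra! hle
  exact hne (h.eq_of_vertex_eq hS hT (h.vertex_eq_of_le hf hT (h.vertex_inClosedCell hS hc) hle))

lemma IsSimple.topCell_injOn (h : IsSimple a b) (hf : IsGeneric a f)
    (hS : S.card = Module.finrank ℝ V) (hT : T.card = Module.finrank ℝ V)
    (heq : topCell a b f S = topCell a b f T) : S = T := by
  by_contra hne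
  have h1 := h.lt_of_agree hf hS hT hne fun i _ => congrFun heq.symm i
  have h2 := h.lt_of_agree hf hT hS (Ne.symm hne) fun i _ => congrFun heq i
  exact lt_asymm h1 h2

/-- Crossing a facet of `topCell S` missing the vertex of `S` leads to a cell with a lower top. -/
lemma IsSimple.exists_lower_topCell (h : IsSimple a b) (hf : IsGeneric a f)
    (hS : S.card = Module.finrank ℝ V) {u : ι → Bool} {x : V} (hx : InOpenCell a b u x) {i : ι}
    (hi : i ∉ S) (hui : u i ≠ topCell a b f S i) (huj : ∀ j, j ≠ i → u j = topCell a b f S j) :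
    ∃ T : Finset ι, T.card = Module.finrank ℝ V ∧ u = topCell a b f T ∧
      f (vertex a b T) < f (vertex a b S) := by
  set c := topCell a b f S with hc
  obtain ⟨y, hy⟩ := exists_inOpenCell_of_vertex (c := c) h hS
    (h.pos_of_eq_topCell (f := f) hS fun _ _ => rfl)
  have hu : u i = !c i := Bool.eq_not_of_ne hui
  have hxi := hx i
  rw [hu, boolSign_not] at hxi
  have hyi := hy i
  set p := boolSign (c i) * (a i y - b i) with hp
  set q := boolSign (c i) * (a i x - b i) with hq
  have hpq : 0 < p - q := by linarith
  set s := p / (p - q) with hs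
  have hs0 : 0 < s := div_pos hyi hpq
  have hs1 : s < 1 := by rw [hs, div_lt_one hpq]; linarith
  have hsm : s * (p - q) = p := div_mul_cancel₀ _ hpq.ne'
  have hx₀i : a i (y + s • (x - y)) = b i := by
    have : boolSign (c i) * (a i (y + s • (x - y)) - b i) = 0 := by
      simp only [map_add, map_smul, map_sub, smul_eq_mul]
      rw [hp, hq] at hsm
      linarith
    exact sub_eq_zero.1 ((mul_eq_zero.1 this).resolve_left (boolSign_ne_zero _))
  have hx₀ : InClosedCell a b c (y + s • (x - y)) := by
    intro j
    by_cases hj : j = i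
    · subst hj; simp [hx₀i]
    · have h1 := hx j
      rw [huj j hj] at h1
      have h2 := hy j
      simp only [map_add, map_smul, map_sub, smul_eq_mul]
      nlinarith
  obtain ⟨T, hT, hiT, hTc, hTs⟩ := h.exists_optimal_vertex hf (E := {i}) hx₀ (by simpa using hx₀i)
    (B := f (vertex a b S)) fun z hz _ => h.le_vertex hf hS hz
  have hiT : i ∈ T := hiT (Finset.mem_singleton_self i)
  have hTS : T ≠ S := fun hTS => hi (hTS ▸ hiT)
  refine ⟨T, hT, h.eq_topCell hT (fun j => ?_) (fun j hj => ?_), ?_⟩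
  · by_cases hj : j = i
    · subst hj; simp [h.vertex_spec hT j hiT]
    · rw [huj j hj]; exact hTc j
  · by_cases hji : j = i
    · subst hji
      rw [hu, boolSign_not]
      by_contra! hge
      have hlt : boolSign (c j) * f (edge a T j) < 0 :=
        lt_of_le_of_ne (by linarith) (mul_ne_zero (boolSign_ne_zero _) (hf T hT j hj))
      refine hTS (h.topCell_injOn hf hT hS (Eq.symm (h.eq_topCell (c := c) hT hTc ?_)))
      intro k hk
      by_cases hkj : k = j
      · exact hkj ▸ hlt
      · exact hTs k hk (by simpa using hkj)
    · rw [huj j hji]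
      exact hTs j hj (by simpa using hji)
  · by_contra! hle
    exact hTS (h.eq_of_vertex_eq hT hS (h.vertex_eq_of_le hf hS hTc hle))

lemma IsSimple.exists_generic (h : IsSimple a b) : ∃ f, IsGeneric a f := by
  obtain ⟨f, hf⟩ := Module.exists_dual_forall_apply_ne_zero (K := ℝ)
    (fun p : {p : Finset ι × ι // p.1.card = Module.finrank ℝ V ∧ p.2 ∈ p.1} =>
      edge a p.1.1 p.1.2) (by
    rintro ⟨⟨S, i⟩, hS, hi⟩ h0
    have := h.edge_spec hS i i hi
    simp only at h0
    simp [h0] at this)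
  exact ⟨f, fun S hS i hi => hf ⟨(S, i), hS, hi⟩⟩

/-- A simple arrangement restricts to a simple arrangement on a generic hyperplane `f = f p`
avoiding all vertices. -/
lemma IsSimple.restrict (h : IsSimple a b) (hf : IsGeneric a f) (hf0 : f ≠ 0) (p : V)
    (hp : ∀ S : Finset ι, S.card = Module.finrank ℝ V → f (vertex a b S) ≠ f p) :
    IsSimple (fun i => (a i).comp (LinearMap.ker f).subtype) (fun i => b i - a i p) := by
  have hfin : Module.finrank ℝ (LinearMap.ker f) + 1 = Module.finrank ℝ V :=
    Module.Dual.finrank_ker_add_one_of_ne_zero hf0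
  refine ⟨fun T hT x hx => ?_, fun S hS x => ?_, by have := h.card_le; omega⟩
  · obtain ⟨i, hi⟩ : ∃ i, i ∉ T := by
      by_contra! hall
      have := Finset.card_le_card (fun i _ => hall i : (Finset.univ : Finset ι) ⊆ T)
      rw [Finset.card_univ] at this
      have := h.card_le
      omega
    have hS : (insert i T).card = Module.finrank ℝ V := by
      rw [Finset.card_insert_of_notMem hi]; omega
    have hiS := Finset.mem_insert_self i T
    have hexp := h.expand_linear hS (x : V)
    rw [Finset.sum_insert hi, Finset.sum_eq_zero (s := T) fun j hj => by
      rw [show a j (x : V) = 0 from hx j hj, zero_smul], add_zero] at hexp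
    have hfx : f (x : V) = 0 := x.2
    rw [hexp, map_smul, smul_eq_mul] at hfx
    have hai := (mul_eq_zero.1 hfx).resolve_right (hf _ hS i hiS)
    rw [hai, zero_smul] at hexp
    exact Subtype.ext hexp
  · by_contra! hall
    rw [hfin] at hS
    refine hp S hS ?_
    rw [← h.eq_vertex hS (x := p + x) fun i hi => ?_]
    · rw [map_add, show f (x : V) = 0 from x.2, add_zero]
    · have : a i (x : V) = b i - a i p := hall i hi
      rw [map_add, this]; ring

/-- For all large `R`, the cells not bounded above by a vertex are those meeting `f = R`. -/
lemma IsSimple.exists_level (h : IsSimple a b) (hf : IsGeneric a f) (C : Finset (ι → Bool))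
    (hC : ∀ c, c ∈ C ↔ ∃ x, InOpenCell a b c x) :
    ∃ R : ℝ, (∀ S : Finset ι, S.card = Module.finrank ℝ V → f (vertex a b S) < R) ∧
      ∀ c, (c ∈ C ∧ ∀ S : Finset ι, S.card = Module.finrank ℝ V → c ≠ topCell a b f S) ↔
        ∃ x, InOpenCell a b c x ∧ f x = R := by
  have hC' : ∀ c, ∃ x, c ∈ C → InOpenCell a b c x := by
    intro c
    by_cases hc : c ∈ C
    · obtain ⟨x, hx⟩ := (hC c).1 hc
      exact ⟨x, fun _ => hx⟩
    · exact ⟨0, fun hc' => absurd hc' hc⟩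
  choose y hy using hC'
  obtain ⟨R₁, hR₁⟩ := (Set.finite_range fun S : Finset ι => f (vertex a b S)).bddAbove
  obtain ⟨R₂, hR₂⟩ := (Set.finite_range fun c : ι → Bool => f (y c)).bddAbove
  have hR₁' : ∀ S, f (vertex a b S) ≤ R₁ := fun S => hR₁ ⟨S, rfl⟩
  have hR₂' : ∀ c, f (y c) ≤ R₂ := fun c => hR₂ ⟨c, rfl⟩
  have hlt : ∀ S, f (vertex a b S) < max R₁ R₂ + 1 := fun S => by
    have := hR₁' S; have := le_max_left R₁ R₂; linarith
  refine ⟨max R₁ R₂ + 1, fun S _ => hlt S, fun c => ⟨?_, ?_⟩⟩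
  · rintro ⟨hc, htop⟩
    set R := max R₁ R₂ + 1 with hR
    have hyR : f (y c) < R := by
      have := hR₂' c; have := le_max_right R₁ R₂; linarith
    have hyc := hy c hc
    obtain ⟨x, hx, hxR⟩ : ∃ x, InClosedCell a b c x ∧ R < f x := by
      by_contra! hall
      obtain ⟨S, hS, -, hv, hsgn⟩ := h.exists_optimal_vertex hf (E := ∅) hyc.inClosedCell
        (by simp) (B := R) fun x hx _ => hall x hx
      exact htop S hS (h.eq_topCell hS hv fun i hi => hsgn i hi (by simp))
    have hd : 0 < f x - f (y c) := by linarith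
    set s := (R - f (y c)) / (f x - f (y c)) with hs
    have hs0 : 0 < s := div_pos (by linarith) hd
    have hs1 : s < 1 := by rw [hs, div_lt_one hd]; linarith
    have hsm : s * (f x - f (y c)) = R - f (y c) := div_mul_cancel₀ _ hd.ne'
    refine ⟨y c + s • (x - y c), fun i => ?_, ?_⟩
    · have h1 := hyc i
      have h2 := hx i
      simp only [map_add, map_smul, map_sub, smul_eq_mul]
      nlinarith
    · simp only [map_add, map_smul, map_sub, smul_eq_mul]
      linarith
  · rintro ⟨x, hx, hxR⟩
    refine ⟨(hC c).2 ⟨x, hx⟩, fun S hS hcS => ?_⟩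
    have := h.le_vertex hf hS (hcS ▸ hx.inClosedCell)
    have := hlt S
    linarith

end Arrangement

/-- A key function `κ` and cube colors `I` which determine a corner-peeling of `C`. -/
structure IsPeelingKey {ι : Type} [Fintype ι] (C : Finset (ι → Bool)) (d : ℕ)
    (κ : (ι → Bool) → ℝ) (I : (ι → Bool) → Finset ι) : Prop where
  cube : ∀ c ∈ C, ∀ u : ι → Bool, (∀ i ∉ I c, u i = c i) → u ≠ c → u ∈ C ∧ κ c < κ u
  flip : ∀ c ∈ C, ∀ u ∈ C, ∀ i ∉ I c, u i ≠ c i → (∀ j, j ≠ i → u j = c j) → κ u < κ c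
  anti : ∀ c ∈ C, ∀ u ∈ C, κ c ≤ κ u → (I u).card ≤ (I c).card
  card_le : ∀ c ∈ C, (I c).card ≤ d
  count : ∀ k ≤ d, (C.filter fun c => (I c).card = k).card = (Fintype.card ι).choose k

theorem IsSimple.exists_peelingKey {ι : Type} [Fintype ι] [DecidableEq ι] (d : ℕ) :
    ∀ {V : Type} [AddCommGroup V] [Module ℝ V] [FiniteDimensional ℝ V]
      {a : ι → Module.Dual ℝ V} {b : ι → ℝ}, Module.finrank ℝ V = d → IsSimple a b →
      ∀ C : Finset (ι → Bool), (∀ c, c ∈ C ↔ ∃ x, InOpenCell a b c x) →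
        ∃ κ I, IsPeelingKey C d κ I := by
  induction d with
  | zero =>
    intro V _ _ _ a b hV h C hC
    have hsub : Subsingleton V := Module.finrank_zero_iff.1 hV
    have hb : ∀ i, a i (0 : V) - b i ≠ 0 := fun i => by
      obtain ⟨j, hj, hne⟩ := h.empty {i} (by simp [hV]) 0
      rw [Finset.mem_singleton.1 hj] at hne
      exact sub_ne_zero.2 hne
    have hC1 : C = {fun i => decide (0 < a i (0 : V) - b i)} := by
      ext c
      rw [hC, Finset.mem_singleton, funext_iff]
      constructor
      · rintro ⟨x, hx⟩ i
        rw [← boolSign_mul_pos_iff (hb i), ← Subsingleton.elim x 0]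
        exact hx i
      · exact fun hc => ⟨0, fun i => (boolSign_mul_pos_iff (hb i)).2 (hc i)⟩
    subst hC1
    refine ⟨fun _ => 0, fun _ => ∅, ?_, ?_, ?_, ?_, ?_⟩
    · intro c _ u hu hne
      exact absurd (funext fun i => hu i (by simp)) hne
    · intro c hc u hu i _ hne
      rw [Finset.mem_singleton.1 hc, Finset.mem_singleton.1 hu] at hne
      exact absurd rfl hne
    · simp
    · simp
    · intro k hk
      obtain rfl : k = 0 := by omega
      simp
  | succ d ih =>
    intro V _ _ _ a b hV h C hC
    classical
    obtain ⟨f, hf⟩ := h.exists_generic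
    have hf0 : f ≠ 0 := by
      rintro rfl
      obtain ⟨S, -, hS⟩ := Finset.exists_subset_card_eq (s := (Finset.univ : Finset ι))
        (by simpa using h.card_le)
      obtain ⟨i, hi⟩ := Finset.card_pos.1 (show 0 < S.card by omega)
      exact hf S hS i hi rfl
    obtain ⟨R, hR, hrest⟩ := h.exists_level hf C hC
    obtain ⟨p, hp⟩ := LinearMap.surjective hf0 R
    have hfin : Module.finrank ℝ (LinearMap.ker f) = d := by
      have := Module.Dual.finrank_ker_add_one_of_ne_zero hf0
      omega
    set top := (Finset.univ.powersetCard (d + 1)).image (topCell a b f) with htop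
    have hmem : ∀ c, c ∈ top ↔ ∃ S : Finset ι, S.card = d + 1 ∧ topCell a b f S = c := by
      intro c; simp [htop]
    have htopC : ∀ S : Finset ι, S.card = d + 1 → ∀ c : ι → Bool,
        (∀ i ∉ S, c i = topCell a b f S i) → c ∈ C := fun S hS c hc =>
      (hC c).2 (exists_inOpenCell_of_vertex h (hS.trans hV.symm)
        (h.pos_of_eq_topCell (hS.trans hV.symm) hc))
    obtain ⟨κ', I', hκ⟩ := ih (V := LinearMap.ker f) hfin
      (h.restrict hf hf0 p fun S hS => hp ▸ (hR S hS).ne) (C \ top) (by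
        intro c
        have : c ∈ C \ top ↔ (c ∈ C ∧ ∀ S : Finset ι, S.card = Module.finrank ℝ V →
            c ≠ topCell a b f S) := by
          rw [Finset.mem_sdiff, hmem, hV]
          refine and_congr_right fun _ => ?_
          push Not
          exact forall₂_congr fun S _ => ne_comm
        rw [this, hrest c]
        constructor
        · rintro ⟨x, hx, hxR⟩
          refine ⟨⟨x - p, by simp [hxR, hp]⟩, fun i => ?_⟩
          have := hx i
          simpa using this
        · rintro ⟨x, hx⟩
          refine ⟨p + x, fun i => ?_, ?_⟩
          · have := hx i
            have heq : a i (p + x) - b i = a i (x : V) - (b i - a i p) := by rw [map_add]; ring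
            rw [heq]
            exact this
          · rw [map_add, show f (x : V) = 0 from x.2, add_zero, hp])
    have hinv : ∃ inv : (ι → Bool) → Finset ι, ∀ S : Finset ι, S.card = d + 1 →
        inv (topCell a b f S) = S := by
      refine ⟨fun c => if hc : ∃ S : Finset ι, S.card = d + 1 ∧ topCell a b f S = c then
        hc.choose else ∅, fun S hS => ?_⟩
      have hex : ∃ T : Finset ι, T.card = d + 1 ∧ topCell a b f T = topCell a b f S := ⟨S, hS, rfl⟩
      simp only [dif_pos hex]
      exact h.topCell_injOn hf (hex.choose_spec.1.trans hV.symm) (hS.trans hV.symm)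
        hex.choose_spec.2
    obtain ⟨inv, hinv⟩ := hinv
    obtain ⟨m, hm⟩ := (Set.finite_range κ').bddBelow
    have hm' : ∀ c, m ≤ κ' c := fun c => hm ⟨c, rfl⟩
    obtain ⟨κ, hκtop, hκrest⟩ : ∃ κ : (ι → Bool) → ℝ,
        (∀ S : Finset ι, S.card = d + 1 → κ (topCell a b f S) = f (vertex a b S)) ∧
        ∀ c ∉ top, κ c = κ' c + (R - m) := by
      refine ⟨fun c => if c ∈ top then f (vertex a b (inv c)) else κ' c + (R - m),
        fun S hS => ?_, fun c hc => if_neg hc⟩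
      simp only [if_pos ((hmem _).2 ⟨S, hS, rfl⟩), hinv S hS]
    obtain ⟨I, hItop, hIrest⟩ : ∃ I : (ι → Bool) → Finset ι,
        (∀ S : Finset ι, S.card = d + 1 → I (topCell a b f S) = S) ∧
        ∀ c ∉ top, I c = I' c := by
      refine ⟨fun c => if c ∈ top then inv c else I' c, fun S hS => ?_, fun c hc => if_neg hc⟩
      simp only [if_pos ((hmem _).2 ⟨S, hS, rfl⟩), hinv S hS]
    have hlt : ∀ S : Finset ι, S.card = d + 1 → ∀ c ∉ top, κ (topCell a b f S) < κ c := by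
      intro S hS c hc
      rw [hκtop S hS, hκrest c hc]
      have := hR S (hS.trans hV.symm)
      have := hm' c
      linarith
    refine ⟨κ, I, ?_, ?_, ?_, ?_, ?_⟩
    · intro c hc u hu hne
      by_cases hct : c ∈ top
      · obtain ⟨S, hS, rfl⟩ := (hmem c).1 hct
        rw [hItop S hS] at hu
        refine ⟨htopC S hS u hu, ?_⟩
        by_cases hut : u ∈ top
        · obtain ⟨T, hT, rfl⟩ := (hmem u).1 hut
          rw [hκtop S hS, hκtop T hT]
          exact h.lt_of_agree hf (hS.trans hV.symm) (hT.trans hV.symm)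
            (fun hST => hne (hST ▸ rfl)) hu
        · exact hlt S hS u hut
      · rw [hIrest c hct] at hu
        obtain ⟨h1, h2⟩ := hκ.cube c (Finset.mem_sdiff.2 ⟨hc, hct⟩) u hu hne
        obtain ⟨huC, hut⟩ := Finset.mem_sdiff.1 h1
        refine ⟨huC, ?_⟩
        rw [hκrest c hct, hκrest u hut]
        linarith
    · intro c hc u hu i hi hui huj
      by_cases hct : c ∈ top
      · obtain ⟨S, hS, rfl⟩ := (hmem c).1 hct
        rw [hItop S hS] at hi
        obtain ⟨x, hx⟩ := (hC u).1 hu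
        obtain ⟨T, hT, rfl, hTS⟩ :=
          h.exists_lower_topCell hf (hS.trans hV.symm) hx hi hui huj
        rwa [hκtop S hS, hκtop T (hT.trans hV)]
      · by_cases hut : u ∈ top
        · obtain ⟨T, hT, rfl⟩ := (hmem u).1 hut
          exact hlt T hT c hct
        · rw [hIrest c hct] at hi
          have := hκ.flip c (Finset.mem_sdiff.2 ⟨hc, hct⟩) u (Finset.mem_sdiff.2 ⟨hu, hut⟩) i hi
            hui huj
          rw [hκrest c hct, hκrest u hut]
          linarith
    · intro c hc u hu hle
      by_cases hut : u ∈ top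
      · obtain ⟨T, hT, rfl⟩ := (hmem u).1 hut
        by_cases hct : c ∈ top
        · obtain ⟨S, hS, rfl⟩ := (hmem c).1 hct
          rw [hItop S hS, hItop T hT, hS, hT]
        · exact absurd hle (not_le.2 (hlt T hT c hct))
      · have hu' := Finset.mem_sdiff.2 ⟨hu, hut⟩
        rw [hIrest u hut]
        by_cases hct : c ∈ top
        · obtain ⟨S, hS, rfl⟩ := (hmem c).1 hct
          rw [hItop S hS, hS]
          exact (hκ.card_le u hu').trans (Nat.le_succ d)
        · rw [hκrest c hct, hκrest u hut] at hle
          rw [hIrest c hct]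
          exact hκ.anti c (Finset.mem_sdiff.2 ⟨hc, hct⟩) u hu' (by linarith)
    · intro c hc
      by_cases hct : c ∈ top
      · obtain ⟨S, hS, rfl⟩ := (hmem c).1 hct
        rw [hItop S hS, hS]
      · rw [hIrest c hct]
        exact (hκ.card_le c (Finset.mem_sdiff.2 ⟨hc, hct⟩)).trans (Nat.le_succ d)
    · intro k hk
      rcases hk.lt_or_eq with hk | rfl
      · rw [← hκ.count k (Nat.lt_succ_iff.1 hk)]
        congr 1
        ext c
        simp only [Finset.mem_filter, Finset.mem_sdiff]
        by_cases hct : c ∈ top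
        · obtain ⟨S, hS, rfl⟩ := (hmem c).1 hct
          simp only [hItop S hS, hS, hct]
          simp
          omega
        · simp [hIrest c hct, hct]
      · have : (C.filter fun c => (I c).card = d + 1) = top := by
          ext c
          rw [Finset.mem_filter]
          constructor
          · rintro ⟨hc, hI⟩
            by_contra hct
            rw [hIrest c hct] at hI
            have := hκ.card_le c (Finset.mem_sdiff.2 ⟨hc, hct⟩)
            omega
          · intro hct
            obtain ⟨S, hS, rfl⟩ := (hmem c).1 hct
            exact ⟨htopC S hS _ fun _ _ => rfl, by rw [hItop S hS, hS]⟩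
        rw [this, htop, Finset.card_image_of_injOn, Finset.card_powersetCard, Finset.card_univ]
        intro S hS T hT heq
        simp only [Finset.mem_coe, Finset.mem_powersetCard] at hS hT
        exact h.topCell_injOn hf (hS.2.trans hV.symm) (hT.2.trans hV.symm) heq

/-- The set of all vectors agreeing with `c` outside `I`. -/
def cubeAt {n : ℕ} (c : Fin n → Bool) (I : Finset (Fin n)) : Finset (Fin n → Bool) :=
  Finset.univ.filter fun u => ∀ i ∉ I, u i = c i

lemma mem_cubeAt {n : ℕ} {c u : Fin n → Bool} {I : Finset (Fin n)} :
    u ∈ cubeAt c I ↔ ∀ i ∉ I, u i = c i := by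
  simp [cubeAt]

lemma IsCube.eq_cubeAt {n : ℕ} {C Q : Finset (Fin n → Bool)} {I : Finset (Fin n)}
    {c : Fin n → Bool} (hQ : IsCube C Q I) (hc : c ∈ Q) : Q = cubeAt c I := by
  ext u
  rw [mem_cubeAt]
  refine ⟨fun hu i hi => hQ.2.1 u hu c hc i hi, fun hu => ?_⟩
  obtain ⟨w, hw, hwu⟩ := hQ.2.2 u
  have : w = u := funext fun i => by
    by_cases hi : i ∈ I
    · exact hwu i hi
    · rw [hQ.2.1 w hw c hc i hi, hu i hi]
  exact this ▸ hw

lemma isCube_cubeAt {n : ℕ} {C : Finset (Fin n → Bool)} {I : Finset (Fin n)}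
    {c : Fin n → Bool} (hC : cubeAt c I ⊆ C) : IsCube C (cubeAt c I) I := by
  refine ⟨hC, fun u hu w hw i hi => ?_, fun p => ⟨fun i => if i ∈ I then p i else c i, ?_, ?_⟩⟩
  · rw [mem_cubeAt.1 hu i hi, mem_cubeAt.1 hw i hi]
  · rw [mem_cubeAt]
    intro i hi
    simp [hi]
  · intro i hi
    simp [hi]

lemma Adj.exists_flip {n : ℕ} {u c : Fin n → Bool} (h : Adj u c) :
    ∃ i, u i ≠ c i ∧ ∀ j, j ≠ i → u j = c j := by
  obtain ⟨i, hi⟩ := Finset.card_eq_one.1 h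
  have hmem : ∀ j, u j ≠ c j ↔ j = i := fun j => by
    simpa using Finset.ext_iff.1 hi j
  exact ⟨i, (hmem i).2 rfl, fun j hj => not_not.1 fun hne => hj ((hmem j).1 hne)⟩

/-- If `D ⊆ C` consists of `c`, all elements of larger key, and possibly others of equal key,
then `c` is a corner of `D`. -/
lemma IsPeelingKey.corner_conditions {n d : ℕ} {C D : Finset (Fin n → Bool)}
    {κ : (Fin n → Bool) → ℝ} {I : (Fin n → Bool) → Finset (Fin n)} (h : IsPeelingKey C d κ I)
    {c : Fin n → Bool} (hc : c ∈ C) (hDC : D ⊆ C) (hD : ∀ u ∈ D, κ c ≤ κ u) (hcD : c ∈ D)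
    (hlt : ∀ u ∈ C, κ c < κ u → u ∈ D) :
    IsCube D (cubeAt c (I c)) (I c) ∧ c ∈ cubeAt c (I c) ∧
      (∀ Q' I', IsCube D Q' I' → c ∈ Q' → I'.card ≤ (I c).card) ∧
      (∀ Q' I', IsCube D Q' I' → c ∈ Q' → I'.card = (I c).card → Q' = cubeAt c (I c)) ∧
      ∀ u ∈ D, Adj u c → u ∈ cubeAt c (I c) := by
  have hflip : ∀ u ∈ D, ∀ i, u i ≠ c i → (∀ j, j ≠ i → u j = c j) → i ∈ I c := by
    intro u hu i hi hj
    by_contra hiI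
    exact not_lt.2 (hD u hu) (h.flip c hc u (hDC hu) i hiI hi hj)
  have hsub : ∀ Q' I', IsCube D Q' I' → c ∈ Q' → I' ⊆ I c := by
    intro Q' I' hQ hcQ i hi
    have hu : Function.update c i (!c i) ∈ Q' := by
      rw [hQ.eq_cubeAt hcQ, mem_cubeAt]
      intro j hj
      exact Function.update_of_ne (ne_of_mem_of_not_mem hi hj).symm _ _
    exact hflip _ (hQ.1 hu) i (by simp) fun j hj => Function.update_of_ne hj _ _
  refine ⟨isCube_cubeAt fun u hu => ?_, mem_cubeAt.2 fun _ _ => rfl,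
    fun Q' I' hQ hcQ => Finset.card_le_card (hsub Q' I' hQ hcQ), fun Q' I' hQ hcQ hcard => ?_,
    fun u hu hadj => ?_⟩
  · by_cases huc : u = c
    · exact huc ▸ hcD
    · obtain ⟨huC, hκ⟩ := h.cube c hc u (mem_cubeAt.1 hu) huc
      exact hlt u huC hκ
  · rw [← Finset.eq_of_subset_of_card_le (hsub Q' I' hQ hcQ) hcard.ge]
    exact hQ.eq_cubeAt hcQ
  · obtain ⟨i, hi, hj⟩ := hadj.exists_flip
    have hiI := hflip u hu i hi hj
    exact mem_cubeAt.2 fun j hjI => hj j fun hji => hjI (hji ▸ hiI)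

/-- The functional `dotR y` on `Fin d → ℝ`. -/
def dotDual {d : ℕ} (y : Fin d → ℝ) : Module.Dual ℝ (Fin d → ℝ) :=
  ∑ j, y j • LinearMap.proj j

lemma dotDual_apply {d : ℕ} (y x : Fin d → ℝ) : dotDual y x = dotR y x := by
  simp [dotDual, dotR]

lemma inOpenCell_dotDual_iff {d n : ℕ} (a : Fin n → Fin d → ℝ) (b : Fin n → ℝ)
    (c : Fin n → Bool) (x : Fin d → ℝ) :
    InOpenCell (fun i => dotDual (a i)) b c x ↔ OnNoHyperplane a b x ∧ signVec a b x = c := by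
  simp only [InOpenCell, OnNoHyperplane, signVec, dotDual_apply, funext_iff, ← forall_and]
  refine forall_congr' fun i => ?_
  by_cases hi : dotR (a i) x = b i
  · simp [hi]
  · rw [boolSign_mul_pos_iff (sub_ne_zero.2 hi)]
    simp [hi, eq_comm]

lemma SimpleArrangement.isSimple {d n : ℕ} {a : Fin n → Fin d → ℝ} {b : Fin n → ℝ}
    (h : SimpleArrangement d a b) (hdn : d ≤ n) : IsSimple (fun i => dotDual (a i)) b := by
  refine ⟨fun S hS x hx => ?_, fun S hS x => ?_, by simpa using hdn⟩
  · rw [Module.finrank_fin_fun] at hS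
    have hspan := (h.1 S hS.le).span_eq_top_of_card_eq_finrank' (by simp [hS])
    have hle : (⊤ : Submodule ℝ (Fin d → ℝ)) ≤ LinearMap.ker (dotDual x) := by
      rw [← hspan, Submodule.span_le]
      rintro _ ⟨i, rfl⟩
      have := hx i i.2
      rw [dotDual_apply] at this
      rw [SetLike.mem_coe, LinearMap.mem_ker, dotDual_apply, ← this]
      exact Finset.sum_congr rfl fun j _ => mul_comm _ _
    have hxx : dotDual x x = 0 := LinearMap.mem_ker.1 (hle Submodule.mem_top)
    rw [dotDual_apply] at hxx
    exact dotProduct_self_eq_zero.1 hxx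
  · rw [Module.finrank_fin_fun] at hS
    by_contra! hall
    exact h.2 S hS ⟨x, fun i hi => by rw [← dotDual_apply]; exact hall i hi⟩

/-- Any `d`-maximum class induced by a simple linear arrangement of `n`
hyperplanes in `ℝ^d` (`n ≥ d ≥ 1`) admits a corner-peeling ordering in which the
dimensions of the removed maximal cubes are non-increasing; moreover for each `0 ≤ i ≤ d`
exactly `binom(n, d-i)` of the removed cubes have dimension `d - i`. -/
theorem stmt10 (d n : ℕ) (hd : 1 ≤ d) (hdn : d ≤ n)
    (a : Fin n → Fin d → ℝ) (b : Fin n → ℝ) (hA : SimpleArrangement d a b)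
    (C : Finset (Fin n → Bool)) (hC : IsInducedClass a b C) (hmax : IsMaximum C d) :
    ∃ (v : Fin C.card → (Fin n → Bool)) (Q : Fin C.card → Finset (Fin n → Bool))
      (I : Fin C.card → Finset (Fin n)),
      IsCornerPeeling C v ∧
      (∀ t, IsCube (Peeled C v t) (Q t) (I t) ∧ v t ∈ Q t ∧
        (∀ Q' I', IsCube (Peeled C v t) Q' I' → v t ∈ Q' → I'.card ≤ (I t).card) ∧
        (∀ Q' I', IsCube (Peeled C v t) Q' I' → v t ∈ Q' → I'.card = (I t).card →
          Q' = Q t) ∧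
        (∀ u ∈ Peeled C v t, Adj u (v t) → u ∈ Q t)) ∧
      (∀ s t : Fin C.card, s ≤ t → (I t).card ≤ (I s).card) ∧
      (∀ i : ℕ, i ≤ d →
        (Finset.univ.filter fun t => (I t).card = d - i).card = Nat.choose n (d - i)) := by
  have hsimple := hA.isSimple hdn
  obtain ⟨κ, I, h⟩ := IsSimple.exists_peelingKey d (by simp) hsimple C fun c =>
    (hC c).trans (exists_congr fun x => (inOpenCell_dotDual_iff a b c x).symm)
  let e := C.equivFin.symm
  let v : Fin C.card → (Fin n → Bool) := fun t => e (Tuple.sort (fun s => κ (e s)) t)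
  have hvC : ∀ t, v t ∈ C := fun t => (e _).2
  have hvinj : Function.Injective v := fun s t hst =>
    (Tuple.sort _).injective (e.injective (Subtype.ext hst))
  have hvsurj : ∀ c ∈ C, ∃ t, v t = c := fun c hc =>
    ⟨(Tuple.sort fun s => κ (e s)).symm (e.symm ⟨c, hc⟩), by simp [v]⟩
  have hmono : ∀ s t, s ≤ t → κ (v s) ≤ κ (v t) := fun s t hst =>
    Tuple.monotone_sort (fun s => κ (e s)) hst
  have hpeel : ∀ t u, u ∈ Peeled C v t ↔ u ∈ C ∧ ∀ s < t, v s ≠ u := by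
    intro t u
    simp [Peeled]
  have hge : ∀ t, ∀ u ∈ Peeled C v t, κ (v t) ≤ κ u := by
    intro t u hu
    obtain ⟨huC, hne⟩ := (hpeel t u).1 hu
    obtain ⟨s, rfl⟩ := hvsurj u huC
    exact hmono t s (not_lt.1 fun hst => hne s hst rfl)
  have hcorner := fun t => h.corner_conditions (hvC t) (D := Peeled C v t)
    (fun u hu => ((hpeel t u).1 hu).1) (hge t)
    ((hpeel t _).2 ⟨hvC t, fun s hs heq => hs.ne (hvinj heq)⟩)
    (fun u hu hlt => (hpeel t u).2
      ⟨hu, fun s hs heq => not_lt.2 (hmono s t hs.le) (heq ▸ hlt)⟩)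
  refine ⟨v, fun t => cubeAt (v t) (I (v t)), fun t => I (v t),
    ⟨hvinj, hvC, fun t => ⟨_, _, hcorner t⟩⟩, hcorner,
    fun s t hst => h.anti _ (hvC s) _ (hvC t) (hmono s t hst), fun i _ => ?_⟩
  have hcount := h.count (d - i) (Nat.sub_le d i)
  rw [Fintype.card_fin] at hcount
  rw [← hcount]
  refine Finset.card_bij (fun t _ => v t) (fun t ht => ?_) (fun s _ t _ hst => hvinj hst)
    fun c hc => ?_
  · simpa [hvC t] using ht
  · obtain ⟨hcC, hcI⟩ := Finset.mem_filter.1 hc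
    obtain ⟨t, rfl⟩ := hvsurj c hcC
    exact ⟨t, by simpa using hcI, rfl⟩

end GeomCompress
end
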